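/- For every closed discrete subset B of ℂ² there exists a properly embedded complex line through B: an injective holomorphic map F : ℂ → ℂ² with F'(z) ≠ 0 for all z ∈ ℂ, which is proper (the preimage of every compact subset of ℂ² is a compact subset of ℂ), and with B ⊆ F(ℂ). -/

import Mathlib

noncomputable section

open Polynomial in
/-- The polynomial shear of `ℂ²` along `(b, -a)` that preserves the linear form `a x + b y`. -/
def polyShear (a b : ℂ) (p : ℂ[X]) : Equiv.Perm (ℂ × ℂ) where
  toFun x := (x.1 + b * p.eval (a * x.1 + b * x.2), x.2 - a * p.eval (a * x.1 + b * x.2))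
  invFun x := (x.1 - b * p.eval (a * x.1 + b * x.2), x.2 + a * p.eval (a * x.1 + b * x.2))
  left_inv x := by
    have h : a * (x.1 + b * p.eval (a * x.1 + b * x.2)) +
        b * (x.2 - a * p.eval (a * x.1 + b * x.2)) = a * x.1 + b * x.2 := by ring
    simp [h]
  right_inv x := by
    have h : a * (x.1 - b * p.eval (a * x.1 + b * x.2)) +
        b * (x.2 + a * p.eval (a * x.1 + b * x.2)) = a * x.1 + b * x.2 := by ring
    simp [h]

theorem polyShear_apply (a b : ℂ) (p : Polynomial ℂ) (x : ℂ × ℂ) :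
    polyShear a b p x =
      (x.1 + b * p.eval (a * x.1 + b * x.2), x.2 - a * p.eval (a * x.1 + b * x.2)) := rfl

theorem polyShear_symm_apply (a b : ℂ) (p : Polynomial ℂ) (x : ℂ × ℂ) :
    (polyShear a b p)⁻¹ x =
      (x.1 - b * p.eval (a * x.1 + b * x.2), x.2 + a * p.eval (a * x.1 + b * x.2)) := rfl

/-- The group of automorphisms of `ℂ²` generated by polynomial shears. -/
def shearGroup : Subgroup (Equiv.Perm (ℂ × ℂ)) :=
  Subgroup.closure {Φ | ∃ a b p, Φ = polyShear a b p}

theorem polyShear_mem (a b : ℂ) (p : Polynomial ℂ) : polyShear a b p ∈ shearGroup :=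
  Subgroup.subset_closure ⟨a, b, p, rfl⟩

/-- Evaluation of a polynomial in two variables at a point of `ℂ × ℂ`. -/
def evalPair (x : ℂ × ℂ) : MvPolynomial (Fin 2) ℂ →+* ℂ := MvPolynomial.eval ![x.1, x.2]

@[simp] theorem evalPair_C (x : ℂ × ℂ) (c : ℂ) : evalPair x (MvPolynomial.C c) = c := by
  simp [evalPair]

@[simp] theorem evalPair_X_zero (x : ℂ × ℂ) : evalPair x (MvPolynomial.X 0) = x.1 := by
  simp [evalPair]

@[simp] theorem evalPair_X_one (x : ℂ × ℂ) : evalPair x (MvPolynomial.X 1) = x.2 := by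
  simp [evalPair]

theorem contDiff_evalPair (P : MvPolynomial (Fin 2) ℂ) :
    ContDiff ℂ 1 fun x : ℂ × ℂ => evalPair x P := by
  induction P using MvPolynomial.induction_on with
  | C a => simpa using contDiff_const
  | add p q hp hq => simpa using hp.add hq
  | mul_X p i hp =>
    fin_cases i
    · simpa using hp.mul contDiff_fst
    · simpa using hp.mul contDiff_snd

/-- A self-map of `ℂ²` whose components are polynomials. -/
def IsPolyMap (f : ℂ × ℂ → ℂ × ℂ) : Prop :=
  ∃ P Q : MvPolynomial (Fin 2) ℂ, ∀ x, f x = (evalPair x P, evalPair x Q)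

theorem IsPolyMap.contDiff {f : ℂ × ℂ → ℂ × ℂ} (hf : IsPolyMap f) : ContDiff ℂ 1 f := by
  obtain ⟨P, Q, h⟩ := hf
  rw [funext h]
  exact (contDiff_evalPair P).prodMk (contDiff_evalPair Q)

theorem evalPair_bind₁ (P Q R : MvPolynomial (Fin 2) ℂ) (x : ℂ × ℂ) :
    evalPair x (MvPolynomial.bind₁ ![P, Q] R) = evalPair (evalPair x P, evalPair x Q) R := by
  induction R using MvPolynomial.induction_on with
  | C a => simp
  | add p q hp hq => simp [hp, hq]
  | mul_X p i hp =>
    fin_cases i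
    · simp [hp]
    · simp [hp]

theorem evalPair_aeval (p : Polynomial ℂ) (P : MvPolynomial (Fin 2) ℂ) (x : ℂ × ℂ) :
    evalPair x (Polynomial.aeval P p) = p.eval (evalPair x P) := by
  induction p using Polynomial.induction_on' with
  | add p q hp hq => simp [hp, hq]
  | monomial n a => simp [Polynomial.aeval_monomial, MvPolynomial.algebraMap_eq]

theorem IsPolyMap.comp {f g : ℂ × ℂ → ℂ × ℂ} (hf : IsPolyMap f) (hg : IsPolyMap g) :
    IsPolyMap (f ∘ g) := by
  obtain ⟨P, Q, h⟩ := hf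
  obtain ⟨P', Q', h'⟩ := hg
  exact ⟨MvPolynomial.bind₁ ![P', Q'] P, MvPolynomial.bind₁ ![P', Q'] Q, fun x => by
    simp [evalPair_bind₁, h, h']⟩

open MvPolynomial in
theorem isPolyMap_of_mem {Φ : Equiv.Perm (ℂ × ℂ)} (h : Φ ∈ shearGroup) : IsPolyMap Φ := by
  suffices IsPolyMap Φ ∧ IsPolyMap (Φ⁻¹ : Equiv.Perm (ℂ × ℂ)) from this.1
  induction h using Subgroup.closure_induction with
  | mem Φ h =>
    obtain ⟨a, b, p, rfl⟩ := h
    constructor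
    · refine ⟨X 0 + C b * Polynomial.aeval (C a * X 0 + C b * X 1) p,
        X 1 - C a * Polynomial.aeval (C a * X 0 + C b * X 1) p, fun x => ?_⟩
      simp [polyShear_apply, evalPair_aeval]
    · refine ⟨X 0 - C b * Polynomial.aeval (C a * X 0 + C b * X 1) p,
        X 1 + C a * Polynomial.aeval (C a * X 0 + C b * X 1) p, fun x => ?_⟩
      simp [polyShear_symm_apply, evalPair_aeval]
  | one => exact ⟨⟨X 0, X 1, fun x => by simp⟩, ⟨X 0, X 1, fun x => by simp⟩⟩
  | mul Φ Ψ _ _ hΦ hΨ =>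
    refine ⟨by simpa using hΦ.1.comp hΨ.1, ?_⟩
    rw [mul_inv_rev]
    simpa using hΨ.2.comp hΦ.2
  | inv Φ _ hΦ => exact ⟨hΦ.2, by simpa using hΦ.1⟩

theorem contDiff_of_mem {Φ : Equiv.Perm (ℂ × ℂ)} (h : Φ ∈ shearGroup) : ContDiff ℂ 1 Φ :=
  (isPolyMap_of_mem h).contDiff

theorem continuous_of_mem {Φ : Equiv.Perm (ℂ × ℂ)} (h : Φ ∈ shearGroup) : Continuous Φ :=
  (contDiff_of_mem h).continuous

theorem ContDiff.exists_lipschitz_closedBall {f : ℂ × ℂ → ℂ × ℂ} (hf : ContDiff ℂ 1 f) (r : ℝ) :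
    ∃ Λ : ℝ, 0 ≤ Λ ∧ ∀ x y, ‖x‖ ≤ r → ‖y‖ ≤ r → ‖f x - f y‖ ≤ Λ * ‖x - y‖ := by
  have hf' : ContDiffOn ℝ 1 f (Metric.closedBall 0 r) := (hf.restrict_scalars ℝ).contDiffOn
  obtain ⟨Λ, hΛ⟩ := hf'.exists_lipschitzOnWith one_ne_zero (convex_closedBall _ _)
    (isCompact_closedBall _ _)
  exact ⟨Λ, Λ.2, fun x y hx hy => hΛ.norm_sub_le (by simpa using hx) (by simpa using hy)⟩

theorem Continuous.exists_bound_closedBall {f : ℂ × ℂ → ℂ × ℂ} (hf : Continuous f) (r : ℝ) :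
    ∃ D : ℝ, 0 ≤ D ∧ ∀ x, ‖x‖ ≤ r → ‖f x‖ ≤ D := by
  obtain ⟨D, hD⟩ :=
    (isCompact_closedBall (0 : ℂ × ℂ) r).exists_bound_of_continuousOn hf.continuousOn
  exact ⟨max D 0, le_max_right _ _, fun x hx => (hD x (by simpa using hx)).trans (le_max_left _ _)⟩

/-- The vector fields `Y` on `ℂ²` that are tangent at `h = 0` to a family `Θ h` in the shear group,
with a quadratic error that is locally uniform. -/
def shearFields : Submodule ℂ (ℂ × ℂ → ℂ × ℂ) where
  carrier := {Y | ContDiff ℂ 1 Y ∧ ∃ Θ : ℂ → Equiv.Perm (ℂ × ℂ), (∀ h, Θ h ∈ shearGroup) ∧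
    ∀ r T : ℝ, ∃ C : ℝ, 0 ≤ C ∧ ∀ h : ℂ, ‖h‖ ≤ T → ∀ x, ‖x‖ ≤ r →
      ‖Θ h x - x - h • Y x‖ ≤ C * ‖h‖ ^ 2}
  zero_mem' := ⟨contDiff_const, fun _ => 1, fun _ => one_mem _, fun r T => ⟨0, le_rfl, by simp⟩⟩
  smul_mem' c Y := by
    rintro ⟨hY, Θ, hΘ, hC⟩
    refine ⟨hY.const_smul c, fun h => Θ (h * c), fun h => hΘ _, fun r T => ?_⟩
    obtain ⟨C, hC0, hC⟩ := hC r (T * ‖c‖)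
    refine ⟨C * ‖c‖ ^ 2, by positivity, fun h hh x hx => ?_⟩
    have := hC (h * c) (by rw [norm_mul]; gcongr) x hx
    rw [norm_mul, mul_pow, mul_smul] at this
    calc _ ≤ _ := this
      _ = _ := by ring
  add_mem' := by
    rintro Y₁ Y₂ ⟨hY₁, Θ₁, hΘ₁, hC₁⟩ ⟨hY₂, Θ₂, hΘ₂, hC₂⟩
    refine ⟨hY₁.add hY₂, fun h => Θ₁ h * Θ₂ h, fun h => mul_mem (hΘ₁ h) (hΘ₂ h), fun r T => ?_⟩
    obtain ⟨C₂, hC₂0, hC₂⟩ := hC₂ r T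
    obtain ⟨D, hD0, hD⟩ := hY₂.continuous.exists_bound_closedBall r
    obtain ⟨C₁, hC₁0, hC₁⟩ := hC₁ (r + |T| * (D + C₂ * |T|)) T
    obtain ⟨Λ, hΛ0, hΛ⟩ := hY₁.exists_lipschitz_closedBall (r + |T| * (D + C₂ * |T|))
    refine ⟨C₁ + C₂ + Λ * (D + C₂ * |T|), by positivity, fun h hh x hx => ?_⟩
    have hT : ‖h‖ ≤ |T| := hh.trans (le_abs_self T)
    have h2 := hC₂ h hh x hx
    set y := Θ₂ h x with hy
    have hyx : ‖y - x‖ ≤ ‖h‖ * (D + C₂ * |T|) := by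
      calc ‖y - x‖ = ‖(y - x - h • Y₂ x) + h • Y₂ x‖ := by simp
        _ ≤ C₂ * ‖h‖ ^ 2 + ‖h‖ * D := by
          refine (norm_add_le _ _).trans (add_le_add h2 ?_)
          rw [norm_smul]; gcongr; exact hD x hx
        _ = ‖h‖ * (D + C₂ * ‖h‖) := by ring
        _ ≤ _ := by gcongr
    have hyx' : ‖y - x‖ ≤ |T| * (D + C₂ * |T|) := hyx.trans (by gcongr)
    have hyr : ‖y‖ ≤ r + |T| * (D + C₂ * |T|) := by
      calc ‖y‖ = ‖x + (y - x)‖ := by simp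
        _ ≤ _ := (norm_add_le _ _).trans (add_le_add hx hyx')
    have hxr : ‖x‖ ≤ r + |T| * (D + C₂ * |T|) := hx.trans (le_add_of_nonneg_right (by positivity))
    have h1 := hC₁ h hh y hyr
    have h3 := hΛ y x hyr hxr
    have h4 : ‖h • (Y₁ y - Y₁ x)‖ ≤ ‖h‖ * (Λ * (‖h‖ * (D + C₂ * |T|))) := by
      rw [norm_smul]; gcongr; exact h3.trans (by gcongr)
    calc ‖(Θ₁ h * Θ₂ h) x - x - h • (Y₁ + Y₂) x‖
        = ‖(Θ₁ h y - y - h • Y₁ y) + (y - x - h • Y₂ x) + h • (Y₁ y - Y₁ x)‖ := by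
          rw [Equiv.Perm.mul_apply, ← hy, Pi.add_apply]; congr 1; module
      _ ≤ C₁ * ‖h‖ ^ 2 + C₂ * ‖h‖ ^ 2 + ‖h‖ * (Λ * (‖h‖ * (D + C₂ * |T|))) :=
          (norm_add₃_le).trans (add_le_add (add_le_add h1 h2) h4)
      _ = _ := by ring

/-- The Hamiltonian vector field of a polynomial on `ℂ²`. -/
def hamField : MvPolynomial (Fin 2) ℂ →ₗ[ℂ] (ℂ × ℂ → ℂ × ℂ) where
  toFun P x := (evalPair x (MvPolynomial.pderiv 1 P), -evalPair x (MvPolynomial.pderiv 0 P))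
  map_add' P Q := by
    ext x
    · simp
    · simp
      ring
  map_smul' c P := by ext x <;> simp [MvPolynomial.smul_eq_C_mul]

theorem hamField_apply (P : MvPolynomial (Fin 2) ℂ) (x : ℂ × ℂ) : hamField P x =
    (evalPair x (MvPolynomial.pderiv 1 P), -evalPair x (MvPolynomial.pderiv 0 P)) := rfl

open MvPolynomial in
theorem hamField_linear_pow_mem (t : ℂ) (n : ℕ) :
    hamField ((X 0 + C t * X 1) ^ n) ∈ shearFields := by
  refine ⟨?_, fun h => polyShear 1 t (Polynomial.C (h * n) * Polynomial.X ^ (n - 1)),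
    fun h => polyShear_mem _ _ _, fun r T => ⟨0, le_rfl, fun h _ x _ => ?_⟩⟩
  · exact (contDiff_evalPair _).prodMk (contDiff_evalPair _).neg
  · rw [zero_mul, norm_le_zero_iff]
    ext <;> simp [polyShear_apply, hamField_apply, pderiv_X, Derivation.leibniz_pow] <;> ring

open MvPolynomial in
theorem hamField_mem (P : MvPolynomial (Fin 2) ℂ) : hamField P ∈ shearFields := by
  have key (n : ℕ) (k : ℕ) (hk : k ≤ n) :
      hamField (X 0 ^ (n - k) * X 1 ^ k) ∈ shearFields := by
    by_contra hcon
    obtain ⟨φ, hφ, hle⟩ := Submodule.exists_le_ker_of_notMem hcon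
    let p : Polynomial ℂ := ∑ k ∈ Finset.range (n + 1),
      Polynomial.C ((n.choose k : ℂ) * φ (hamField (X 0 ^ (n - k) * X 1 ^ k))) * Polynomial.X ^ k
    have hp : p = 0 := by
      refine Polynomial.funext fun t => ?_
      have h0 : φ (hamField ((X 0 + C t * X 1) ^ n)) = 0 := hle (hamField_linear_pow_mem t n)
      rw [Polynomial.eval_zero, ← h0, add_comm (X 0), add_pow, map_sum, map_sum]
      simp only [p, Polynomial.eval_finsetSum]
      refine Finset.sum_congr rfl fun k _ => ?_
      have : (C t * X 1) ^ k * X 0 ^ (n - k) * (n.choose k : MvPolynomial (Fin 2) ℂ) =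
          (t ^ k * n.choose k) • (X 0 ^ (n - k) * X 1 ^ k) := by
        rw [MvPolynomial.smul_eq_C_mul]; simp; ring
      rw [this]
      simp only [map_smul, Polynomial.eval_mul, Polynomial.eval_C, Polynomial.eval_pow,
        Polynomial.eval_X, smul_eq_mul]
      ring
    have hcoeff : p.coeff k = 0 := by simp [hp]
    simp only [p, Polynomial.finsetSum_coeff, Polynomial.coeff_C_mul_X_pow] at hcoeff
    rw [Finset.sum_ite_eq, if_pos (by simpa using Nat.lt_succ_of_le hk)] at hcoeff
    refine hφ ((mul_eq_zero.mp hcoeff).resolve_left ?_)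
    exact_mod_cast (Nat.choose_pos hk).ne'
  induction P using MvPolynomial.induction_on' with
  | monomial u a =>
    have : monomial u a = a • (X 0 ^ (u 0 + u 1 - u 1) * X 1 ^ u 1 : MvPolynomial (Fin 2) ℂ) := by
      rw [MvPolynomial.monomial_eq, MvPolynomial.smul_eq_C_mul, Finsupp.prod_fintype _ _ (by simp)]
      simp
    rw [this, map_smul]
    exact Submodule.smul_mem _ _ (key _ _ (Nat.le_add_left _ _))
  | add p q hp hq => rw [map_add]; exact Submodule.add_mem _ hp hq

/-- One step of the explicit Euler scheme with step `1 / m`. -/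
def eulerStep (Y : ℂ × ℂ → ℂ × ℂ) (m : ℕ) (x : ℂ × ℂ) : ℂ × ℂ := x + ((1 : ℂ) / m) • Y x

theorem exists_approx_euler {Y : ℂ × ℂ → ℂ × ℂ} (hY : Y ∈ shearFields) (r : ℝ) {ε : ℝ}
    (hε : 0 < ε) : ∃ Θ ∈ shearGroup, ∃ m : ℕ, 0 < m ∧ ∀ x,
      (∀ j ≤ m, ‖(eulerStep Y m)^[j] x‖ ≤ r) → ‖Θ x - (eulerStep Y m)^[m] x‖ ≤ ε := by
  obtain ⟨hY, Θ, hΘ, hC⟩ := hY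
  obtain ⟨C, hC0, hC⟩ := hC (r + 1) 1
  obtain ⟨Λ, hΛ0, hΛ⟩ := hY.exists_lipschitz_closedBall (r + 1)
  obtain ⟨m, hm⟩ := exists_nat_gt (C * Real.exp Λ / min ε 1 + 1)
  have hμ : 0 < min ε 1 := lt_min hε one_pos
  have hm0 : (0 : ℝ) < m := lt_of_le_of_lt (by positivity) hm
  have hmN : 0 < m := by exact_mod_cast hm0
  have hm1 : (1 : ℝ) ≤ m := by exact_mod_cast hmN
  have hsmall : C * Real.exp Λ / m ≤ min ε 1 := by
    rw [div_le_iff₀ hm0]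
    have : C * Real.exp Λ / min ε 1 ≤ m := by linarith
    rw [div_le_iff₀ hμ] at this
    linarith
  set h : ℂ := 1 / m with hh
  have hhn : ‖h‖ = 1 / m := by simp [hh]
  refine ⟨Θ h ^ m, pow_mem (hΘ h) m, m, hmN, fun x hx => ?_⟩
  have hgrow (j : ℕ) (hj : j ≤ m) : C * (1 / m) ^ 2 * j * (1 + Λ / m) ^ j ≤ min ε 1 := by
    calc C * (1 / m) ^ 2 * j * (1 + Λ / m) ^ j
        ≤ C * (1 / m) ^ 2 * m * (1 + Λ / m) ^ m := by
          gcongr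
          exact le_add_of_nonneg_right (by positivity)
      _ ≤ C * (1 / m) ^ 2 * m * Real.exp Λ := by
          gcongr
          calc (1 + Λ / m) ^ m ≤ Real.exp (Λ / m) ^ m := by
                gcongr; rw [add_comm]; exact Real.add_one_le_exp _
            _ = Real.exp Λ := by rw [← Real.exp_nat_mul]; congr 1; field_simp
      _ = C * Real.exp Λ / m := by field_simp
      _ ≤ _ := hsmall
  have main (j : ℕ) (hj : j ≤ m) : ‖(Θ h ^ j) x - (eulerStep Y m)^[j] x‖ ≤
      C * (1 / m) ^ 2 * j * (1 + Λ / m) ^ j := by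
    induction j with
    | zero => simp
    | succ j ih =>
      have ih := ih (by omega)
      have hd := ih.trans ((hgrow j (by omega)).trans (min_le_right _ _))
      rw [pow_succ', Equiv.Perm.mul_apply, Function.iterate_succ_apply']
      have he := hx j (by omega)
      set y := (Θ h ^ j) x
      set e := (eulerStep Y m)^[j] x
      have hy : ‖y‖ ≤ r + 1 := by
        calc ‖y‖ = ‖e + (y - e)‖ := by simp
          _ ≤ _ := (norm_add_le _ _).trans (add_le_add he hd)
      have h1 := hC h (by rw [hhn, div_le_one hm0]; exact hm1) y hy
      have h2 := hΛ y e hy (by linarith)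
      rw [hhn] at h1
      have h3 : ‖h • (Y y - Y e)‖ ≤ (1 / m) * (Λ * ‖y - e‖) := by
        rw [norm_smul, hhn]; gcongr
      have hpow : (1 : ℝ) ≤ (1 + Λ / m) ^ (j + 1) :=
        one_le_pow₀ (le_add_of_nonneg_right (by positivity))
      calc ‖Θ h y - eulerStep Y m e‖
          = ‖(Θ h y - y - h • Y y) + (y - e) + h • (Y y - Y e)‖ := by
            rw [eulerStep]; congr 1; module
        _ ≤ C * (1 / m) ^ 2 + ‖y - e‖ + (1 / m) * (Λ * ‖y - e‖) :=
            norm_add₃_le.trans (add_le_add (add_le_add h1 le_rfl) h3)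
        _ = C * (1 / m) ^ 2 * 1 + (1 + Λ / m) * ‖y - e‖ := by ring
        _ ≤ C * (1 / m) ^ 2 * (1 + Λ / m) ^ (j + 1) +
            (1 + Λ / m) * (C * (1 / m) ^ 2 * j * (1 + Λ / m) ^ j) := by gcongr
        _ = _ := by push_cast; ring
  exact (main m le_rfl).trans ((hgrow m le_rfl).trans (min_le_left _ _))

open MvPolynomial in
/-- The Hamiltonian `k ℓ ^ (N + 1) (ℓ - 1) Q ^ 2` with `ℓ = a x + b y`. -/
def pushHamiltonian (a b k : ℂ) (Q : MvPolynomial (Fin 2) ℂ) (N : ℕ) : MvPolynomial (Fin 2) ℂ :=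
  C k * ((C a * X 0 + C b * X 1) ^ (N + 1) * (C a * X 0 + C b * X 1 - 1) * Q ^ 2)

theorem hamField_pushHamiltonian (a b k : ℂ) (Q : MvPolynomial (Fin 2) ℂ) (N : ℕ) (x : ℂ × ℂ) :
    hamField (pushHamiltonian a b k Q N) x =
      (k * ((a * x.1 + b * x.2) ^ (N + 1) * (a * x.1 + b * x.2 - 1) * (2 * evalPair x Q))) •
          hamField Q x +
        (k * (evalPair x Q ^ 2 * ((N + 1) * (a * x.1 + b * x.2) ^ N * (a * x.1 + b * x.2 - 1) +
          (a * x.1 + b * x.2) ^ (N + 1)))) • (b, -a) := by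
  have h2 : evalPair x 2 = 2 := map_ofNat _ 2
  ext <;> simp [h2, hamField_apply, pushHamiltonian, Derivation.leibniz, Derivation.leibniz_pow,
    MvPolynomial.pderiv_X] <;> ring

theorem norm_linearForm_le (a b : ℂ) (x : ℂ × ℂ) :
    ‖a * x.1 + b * x.2‖ ≤ (‖a‖ + ‖b‖) * ‖x‖ := by
  calc ‖a * x.1 + b * x.2‖ ≤ ‖a‖ * ‖x.1‖ + ‖b‖ * ‖x.2‖ := by
        simpa using norm_add_le (a * x.1) (b * x.2)
    _ ≤ ‖a‖ * ‖x‖ + ‖b‖ * ‖x‖ := by gcongr; exacts [norm_fst_le x, norm_snd_le x]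
    _ = _ := by ring

open Filter Topology in
theorem exists_hamField_pushHamiltonian_le (a b k : ℂ) (Q : MvPolynomial (Fin 2) ℂ) (r : ℝ)
    {θ : ℝ} (hθ0 : 0 ≤ θ) (hθ : θ < 1) {ε : ℝ} (hε : 0 < ε) :
    ∃ N : ℕ, ∀ x : ℂ × ℂ, ‖x‖ ≤ r → ‖a * x.1 + b * x.2‖ ≤ θ →
      ‖hamField (pushHamiltonian a b k Q N) x‖ ≤ ε := by
  obtain ⟨D, hD0, hD⟩ := Continuous.exists_bound_closedBall
    ((contDiff_evalPair Q).continuous.prodMk continuous_const : Continuous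
      fun x : ℂ × ℂ => (evalPair x Q, (0 : ℂ))) r
  obtain ⟨D', hD0', hD'⟩ := Continuous.exists_bound_closedBall
    (hamField_mem Q).1.continuous r
  set M : ℝ := ‖k‖ * (4 * D * D' + 3 * D ^ 2 * ‖((b, -a) : ℂ × ℂ)‖) with hM
  have hlim : Tendsto (fun N : ℕ => M * ((N + 1) * θ ^ N)) atTop (𝓝 0) := by
    have h1 := tendsto_self_mul_const_pow_of_lt_one hθ0 hθ
    have h2 := tendsto_pow_atTop_nhds_zero_of_lt_one hθ0 hθ
    have := (h1.add h2).const_mul M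
    simpa [add_mul] using this
  obtain ⟨N, hN⟩ := (hlim.eventually (gt_mem_nhds hε)).exists
  refine ⟨N, fun x hx hl => le_trans ?_ hN.le⟩
  rw [hamField_pushHamiltonian]
  set l := a * x.1 + b * x.2
  have hQ : ‖evalPair x Q‖ ≤ D := (norm_fst_le (evalPair x Q, (0 : ℂ))).trans (hD x hx)
  have hl1 : ‖l - 1‖ ≤ 2 := by
    have := norm_sub_le l 1
    rw [norm_one] at this
    linarith
  have hpow : ‖l‖ ^ N ≤ θ ^ N := by gcongr
  have hpow' : ‖l‖ ^ (N + 1) ≤ (N + 1) * θ ^ N := by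
    calc ‖l‖ ^ (N + 1) = ‖l‖ * ‖l‖ ^ N := pow_succ' _ _
      _ ≤ (N + 1) * θ ^ N := by gcongr; linarith [(Nat.cast_nonneg N : (0 : ℝ) ≤ N)]
  have hN1 : ‖(N + 1 : ℂ)‖ = N + 1 := by
    rw [← Nat.cast_succ, Complex.norm_natCast]; simp
  refine (norm_add_le _ _).trans ?_
  rw [norm_smul, norm_smul]
  have e1 : ‖k * (l ^ (N + 1) * (l - 1) * (2 * evalPair x Q))‖ ≤
      ‖k‖ * (((N + 1) * θ ^ N) * 2 * (2 * D)) := by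
    simp only [norm_mul, norm_pow, Complex.norm_ofNat]
    gcongr
  have e2 : ‖k * (evalPair x Q ^ 2 * ((N + 1) * l ^ N * (l - 1) + l ^ (N + 1)))‖ ≤
      ‖k‖ * (D ^ 2 * ((N + 1) * θ ^ N * 2 + (N + 1) * θ ^ N)) := by
    rw [norm_mul, norm_mul, norm_pow]
    gcongr
    refine (norm_add_le _ _).trans ?_
    simp only [norm_mul, norm_pow, hN1]
    gcongr
  calc _ ≤ ‖k‖ * (((N + 1) * θ ^ N) * 2 * (2 * D)) * D' +
        ‖k‖ * (D ^ 2 * ((N + 1) * θ ^ N * 2 + (N + 1) * θ ^ N)) * ‖((b, -a) : ℂ × ℂ)‖ := by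
        gcongr; exact hD' x hx
    _ = _ := by rw [hM]; ring

open Filter Topology in
theorem exists_local_push (a b : ℂ) (Q : MvPolynomial (Fin 2) ℂ) {K : Set (ℂ × ℂ)} {r θ : ℝ}
    (hθ0 : 0 ≤ θ) (hθ : θ < 1)
    (hK : ∀ x ∈ K, ‖x‖ ≤ r ∧ (‖a * x.1 + b * x.2‖ ≤ θ ∨ evalPair x Q = 0))
    {p : ℂ × ℂ} (hp : a * p.1 + b * p.2 = 1) (hQ : evalPair p Q ≠ 0) :
    ∃ s₀ > 0, ∀ s : ℂ, ‖s‖ < s₀ → ∀ ε > 0, ∃ Θ ∈ shearGroup, (∀ x ∈ K, ‖Θ x - x‖ ≤ ε) ∧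
      ∃ τ : ℂ, ‖τ - s‖ ≤ ‖s‖ / 4 ∧ ‖Θ p - (p + τ • (b, -a))‖ ≤ ε := by
  set v : ℂ × ℂ := (b, -a) with hv
  have hcont : Continuous fun τ : ℂ => evalPair (p + τ • v) Q ^ 2 / evalPair p Q ^ 2 := by
    have := (contDiff_evalPair Q).continuous
    fun_prop
  have hev : ∀ᶠ τ : ℂ in 𝓝 0,
      ‖evalPair (p + τ • v) Q ^ 2 / evalPair p Q ^ 2 - 1‖ < 1 / 4 := by
    have : Continuous fun τ : ℂ =>
      ‖evalPair (p + τ • v) Q ^ 2 / evalPair p Q ^ 2 - 1‖ := (hcont.sub continuous_const).norm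
    refine this.continuousAt.eventually (gt_mem_nhds ?_)
    simp [hQ]
  obtain ⟨δ, hδ0, hδ⟩ := Metric.eventually_nhds_iff.mp hev
  refine ⟨δ / 2, by positivity, fun s hs ε hε => ?_⟩
  set η : ℝ := min (min (ε / 2) 1) ((1 - θ) / 2 / (‖a‖ + ‖b‖ + 1)) with hη
  have hη0 : 0 < η := lt_min (lt_min (by positivity) one_pos)
    (div_pos (by linarith) (by positivity))
  have hη1 : η ≤ 1 := (min_le_left _ _).trans (min_le_right _ _)
  have hηε : η ≤ ε / 2 := (min_le_left _ _).trans (min_le_left _ _)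
  have hηθ : (‖a‖ + ‖b‖) * η ≤ (1 - θ) / 2 := by
    have h1 : η ≤ (1 - θ) / 2 / (‖a‖ + ‖b‖ + 1) := min_le_right _ _
    rw [le_div_iff₀ (by positivity)] at h1
    nlinarith
  obtain ⟨N, hN⟩ := exists_hamField_pushHamiltonian_le a b (s / evalPair p Q ^ 2) Q (r + 1)
    (θ := (1 + θ) / 2) (by linarith) (by linarith) hη0
  set Y := hamField (pushHamiltonian a b (s / evalPair p Q ^ 2) Q N) with hY
  obtain ⟨Θ, hΘ, m, hm, hE⟩ := exists_approx_euler (hamField_mem _ : Y ∈ shearFields)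
    (max (r + 1) (‖p‖ + 2 * ‖s‖ * ‖v‖)) (half_pos hε)
  have hm0 : (0 : ℝ) < m := by exact_mod_cast hm
  have hmn : ‖(1 / m : ℂ)‖ = 1 / m := by simp
  have hjm (j : ℕ) (hj : j ≤ m) : (j : ℝ) / m ≤ 1 := by
    rw [div_le_one hm0]; exact_mod_cast hj
  refine ⟨Θ, hΘ, fun x hx => ?_, ?_⟩
  · suffices h : ∀ j ≤ m, ‖(eulerStep Y m)^[j] x - x‖ ≤ j / m * η by
      have hle : ∀ j ≤ m, ‖(eulerStep Y m)^[j] x - x‖ ≤ η := fun j hj =>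
        (h j hj).trans (mul_le_of_le_one_left hη0.le (hjm j hj))
      have h1 := hE x fun j hj => le_max_of_le_left <| by
        calc ‖(eulerStep Y m)^[j] x‖ = ‖x + ((eulerStep Y m)^[j] x - x)‖ := by simp
          _ ≤ r + 1 := (norm_add_le _ _).trans (add_le_add (hK x hx).1 ((hle j hj).trans hη1))
      calc ‖Θ x - x‖ = ‖(Θ x - (eulerStep Y m)^[m] x) + ((eulerStep Y m)^[m] x - x)‖ := by simp
        _ ≤ ε / 2 + ε / 2 := (norm_add_le _ _).trans (add_le_add h1 ((hle m le_rfl).trans hηε))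
        _ = ε := by ring
    obtain ⟨hxr, hl | hQ0⟩ := hK x hx
    · intro j hj
      induction j with
      | zero => simp
      | succ j ih =>
        have ih := ih (by omega)
        rw [Function.iterate_succ_apply']
        set e := (eulerStep Y m)^[j] x
        have hex : ‖e - x‖ ≤ η := ih.trans (mul_le_of_le_one_left hη0.le (hjm j (by omega)))
        have her : ‖e‖ ≤ r + 1 := by
          calc ‖e‖ = ‖x + (e - x)‖ := by simp
            _ ≤ _ := (norm_add_le _ _).trans (add_le_add hxr (hex.trans hη1))
        have hle : ‖a * e.1 + b * e.2‖ ≤ (1 + θ) / 2 := by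
          calc ‖a * e.1 + b * e.2‖
              = ‖(a * x.1 + b * x.2) + (a * (e - x).1 + b * (e - x).2)‖ := by
                congr 1; simp; ring
            _ ≤ θ + (‖a‖ + ‖b‖) * ‖e - x‖ :=
                (norm_add_le _ _).trans (add_le_add hl (norm_linearForm_le _ _ _))
            _ ≤ θ + (‖a‖ + ‖b‖) * η := by gcongr
            _ ≤ _ := by linarith
        calc ‖eulerStep Y m e - x‖ = ‖(e - x) + (1 / m : ℂ) • Y e‖ := by
              rw [eulerStep]; congr 1; abel
          _ ≤ j / m * η + 1 / m * η := by
              refine (norm_add_le _ _).trans (add_le_add ih ?_)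
              rw [norm_smul, hmn]
              gcongr
              exact hN e her hle
          _ = _ := by push_cast; ring
    · have hfix : eulerStep Y m x = x := by
        rw [eulerStep, hY, hamField_pushHamiltonian, hQ0]; simp
      intro j _
      rw [Function.iterate_fixed hfix]
      simp only [sub_self, norm_zero]
      positivity
  · have h : ∀ j ≤ m, ∃ τ : ℂ, (eulerStep Y m)^[j] p = p + τ • v ∧
        ‖τ - (j / m : ℂ) * s‖ ≤ j / m * (‖s‖ / 4) := by
      intro j hj
      induction j with
      | zero => exact ⟨0, by simp⟩
      | succ j ih =>
        obtain ⟨τ, he, hτ⟩ := ih (by omega)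
        set g := evalPair (p + τ • v) Q ^ 2 / evalPair p Q ^ 2 with hg
        have hτs : ‖τ‖ < δ := by
          calc ‖τ‖ = ‖(τ - (j / m : ℂ) * s) + (j / m : ℂ) * s‖ := by simp
            _ ≤ j / m * (‖s‖ / 4) + j / m * ‖s‖ := by
              refine (norm_add_le _ _).trans (add_le_add hτ ?_)
              simp
            _ ≤ 1 * (‖s‖ / 4) + 1 * ‖s‖ := by gcongr <;> exact hjm j (by omega)
            _ < δ := by linarith [norm_nonneg s]
        have hg1 : ‖g - 1‖ < 1 / 4 := hδ (by simpa using hτs)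
        have hl : a * (p + τ • v).1 + b * (p + τ • v).2 = 1 := by
          rw [← hp]; simp [hv]; ring
        refine ⟨τ + 1 / m * (s * g), ?_, ?_⟩
        · rw [Function.iterate_succ_apply', he, eulerStep, hY, hamField_pushHamiltonian, hl, hg]
          ext <;> simp <;> ring
        · calc ‖τ + 1 / m * (s * g) - ((j + 1 : ℕ) / m : ℂ) * s‖
              = ‖(τ - (j / m : ℂ) * s) + (1 / m : ℂ) * (s * (g - 1))‖ := by
                congr 1; push_cast; ring
            _ ≤ j / m * (‖s‖ / 4) + 1 / m * (‖s‖ * (1 / 4)) := by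
                refine (norm_add_le _ _).trans (add_le_add hτ ?_)
                rw [norm_mul, norm_mul, hmn]
                gcongr
            _ = _ := by push_cast; ring
    have hτ2 (j : ℕ) (hj : j ≤ m) (τ : ℂ) (hτ : ‖τ - (j / m : ℂ) * s‖ ≤ j / m * (‖s‖ / 4)) :
        ‖τ‖ ≤ 2 * ‖s‖ := by
      calc ‖τ‖ = ‖(τ - (j / m : ℂ) * s) + (j / m : ℂ) * s‖ := by simp
        _ ≤ j / m * (‖s‖ / 4) + j / m * ‖s‖ := by
          refine (norm_add_le _ _).trans (add_le_add hτ ?_)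
          simp
        _ ≤ 1 * (‖s‖ / 4) + 1 * ‖s‖ := by gcongr <;> exact hjm j hj
        _ ≤ _ := by linarith [norm_nonneg s]
    have hE := hE p fun j hj => le_max_of_le_right <| by
      obtain ⟨τ, he, hτ⟩ := h j hj
      rw [he]
      refine (norm_add_le _ _).trans ?_
      rw [norm_smul]
      gcongr
      exact hτ2 j hj τ hτ
    obtain ⟨τ, he, hτ⟩ := h m le_rfl
    refine ⟨τ, ?_, ?_⟩
    · have : (m : ℂ) ≠ 0 := by exact_mod_cast hm.ne'
      rwa [div_self this, div_self hm0.ne', one_mul, one_mul] at hτ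
    · rw [← he]
      exact hE.trans (by linarith)

theorem exists_delta_of_mem {Φ : Equiv.Perm (ℂ × ℂ)} (hΦ : Φ ∈ shearGroup) (r : ℝ) {ε : ℝ}
    (hε : 0 < ε) : ∃ δ > 0, ∀ x y, ‖x‖ ≤ r → ‖y - x‖ ≤ δ → ‖Φ y - Φ x‖ ≤ ε := by
  obtain ⟨Λ, hΛ0, hΛ⟩ := (contDiff_of_mem hΦ).exists_lipschitz_closedBall (r + 1)
  refine ⟨min 1 (ε / (Λ + 1)), lt_min one_pos (by positivity), fun x y hx hyx => ?_⟩
  have h1 : ‖y - x‖ ≤ 1 := hyx.trans (min_le_left _ _)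
  have h2 : ‖y - x‖ ≤ ε / (Λ + 1) := hyx.trans (min_le_right _ _)
  have hy : ‖y‖ ≤ r + 1 := by
    calc ‖y‖ = ‖x + (y - x)‖ := by simp
      _ ≤ _ := (norm_add_le _ _).trans (add_le_add hx h1)
  rw [le_div_iff₀ (by positivity)] at h2
  nlinarith [hΛ y x hy (by linarith), norm_nonneg (y - x)]

/-- The point `p` can be moved arbitrarily close to `q` by elements of the shear group that are
arbitrarily close to the identity on `K`. -/
def Reaches (K : Set (ℂ × ℂ)) (p q : ℂ × ℂ) : Prop :=
  ∀ ε > 0, ∃ Φ ∈ shearGroup, (∀ x ∈ K, ‖Φ x - x‖ ≤ ε) ∧ ‖Φ p - q‖ ≤ ε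

theorem Reaches.refl (K : Set (ℂ × ℂ)) (p : ℂ × ℂ) : Reaches K p p := fun ε hε =>
  ⟨1, one_mem _, fun x _ => by simpa using hε.le, by simpa using hε.le⟩

theorem Reaches.trans {K : Set (ℂ × ℂ)} {r : ℝ} (hK : ∀ x ∈ K, ‖x‖ ≤ r) {p q q' : ℂ × ℂ}
    (h : Reaches K p q) (h' : Reaches K q q') : Reaches K p q' := by
  intro ε hε
  obtain ⟨Ψ, hΨ, hΨK, hΨq⟩ := h' (ε / 2) (half_pos hε)
  obtain ⟨δ, hδ0, hδ⟩ := exists_delta_of_mem hΨ (max r ‖q‖) (half_pos hε)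
  obtain ⟨Φ, hΦ, hΦK, hΦp⟩ := h δ hδ0
  have key (x y z : ℂ × ℂ) (hy : ‖y‖ ≤ max r ‖q‖) (hx : ‖Φ x - y‖ ≤ δ) (hz : ‖Ψ y - z‖ ≤ ε / 2) :
      ‖(Ψ * Φ) x - z‖ ≤ ε := by
    calc ‖(Ψ * Φ) x - z‖ = ‖(Ψ (Φ x) - Ψ y) + (Ψ y - z)‖ := by simp
      _ ≤ ε / 2 + ε / 2 := (norm_add_le _ _).trans (add_le_add (hδ y _ hy hx) hz)
      _ = ε := by ring
  exact ⟨Ψ * Φ, mul_mem hΨ hΦ, fun x hx => key x x x (le_max_of_le_left (hK x hx)) (hΦK x hx)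
    (hΨK x hx), key p q q' (le_max_right _ _) hΦp hΨq⟩

theorem isClosed_reaches (K : Set (ℂ × ℂ)) (p : ℂ × ℂ) : IsClosed {q | Reaches K p q} := by
  refine isClosed_of_closure_subset fun q hq ε hε => ?_
  obtain ⟨q', hq', hd⟩ := Metric.mem_closure_iff.mp hq (ε / 2) (half_pos hε)
  obtain ⟨Φ, hΦ, hK, hp⟩ := hq' (ε / 2) (half_pos hε)
  refine ⟨Φ, hΦ, fun x hx => (hK x hx).trans (by linarith), ?_⟩
  rw [dist_comm, dist_eq_norm] at hd
  calc ‖Φ p - q‖ = ‖(Φ p - q') + (q' - q)‖ := by simp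
    _ ≤ ε / 2 + ε / 2 := (norm_add_le _ _).trans (add_le_add hp hd.le)
    _ = ε := by ring

/-- A closed subset of the plane from which, inside a preconnected open set `U`, one can move
approximately in every direction contains `U` as soon as it meets it. -/
theorem subset_of_approx_moves {A U : Set ℂ} (hA : IsClosed A) (hU : IsOpen U)
    (hUc : IsPreconnected U) (hAU : (U ∩ A).Nonempty)
    (h : ∀ τ ∈ A ∩ U, ∃ s₀ > 0, ∀ s : ℂ, ‖s‖ < s₀ → ∃ τ' ∈ A, ‖τ' - (τ + s)‖ ≤ ‖s‖ / 4) :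
    U ⊆ A := by
  have hopen : IsOpen (A ∩ U) := by
    refine Metric.isOpen_iff.mpr fun τ₀ hτ₀ => ?_
    obtain ⟨ρ, hρ0, hρ⟩ := Metric.isOpen_iff.mp hU τ₀ hτ₀.2
    refine ⟨ρ / 4, by positivity, fun t ht => ⟨?_, hρ (Metric.ball_subset_ball (by linarith) ht)⟩⟩
    rw [Metric.mem_ball] at ht
    have hcomp : IsCompact (A ∩ Metric.closedBall τ₀ (ρ / 2)) :=
      (isCompact_closedBall _ _).inter_left hA
    obtain ⟨w, ⟨hwA, hwρ⟩, hw⟩ := hcomp.exists_isMinOn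
      ⟨τ₀, hτ₀.1, Metric.mem_closedBall_self (by positivity)⟩
      (f := fun w => dist w t) (by fun_prop)
    have hw : ∀ y ∈ A, dist y τ₀ ≤ ρ / 2 → dist w t ≤ dist y t := fun y hy hy' =>
      hw ⟨hy, hy'⟩
    have hwt : dist w t < ρ / 4 :=
      (hw τ₀ hτ₀.1 (by rw [dist_self]; positivity)).trans_lt (by rwa [dist_comm])
    by_contra htA
    have hne : w ≠ t := fun he => htA (he ▸ hwA)
    have hpos : 0 < dist w t := dist_pos.mpr hne
    obtain ⟨s₀, hs₀, hs⟩ := h w ⟨hwA, hρ (Metric.closedBall_subset_ball (by linarith) hwρ)⟩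
    set σ : ℝ := min 1 (s₀ / (2 * dist w t)) with hσ
    have hσ0 : 0 < σ := lt_min one_pos (by positivity)
    have hσ1 : σ ≤ 1 := min_le_left _ _
    have hσs : σ * dist w t < s₀ := by
      have : σ ≤ s₀ / (2 * dist w t) := min_le_right _ _
      rw [le_div_iff₀ (by positivity)] at this
      linarith
    have hn : ‖(σ : ℂ) * (t - w)‖ = σ * dist w t := by
      rw [norm_mul, Complex.norm_real, Real.norm_of_nonneg hσ0.le, dist_comm, dist_eq_norm]
    obtain ⟨y, hyA, hy⟩ := hs (σ * (t - w)) (by rwa [hn])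
    have hyt : dist y t < dist w t := by
      calc dist y t = ‖(y - (w + σ * (t - w))) + ((1 - σ : ℝ) : ℂ) * (w - t)‖ := by
            rw [dist_eq_norm]; congr 1; push_cast; ring
        _ ≤ σ * dist w t / 4 + (1 - σ) * dist w t := by
            refine (norm_add_le _ _).trans (add_le_add (hn ▸ hy) ?_)
            rw [norm_mul, Complex.norm_real, Real.norm_of_nonneg (by linarith), dist_eq_norm]
        _ < dist w t := by nlinarith
    refine absurd (hw y hyA ?_) (not_le.mpr hyt)
    calc dist y τ₀ ≤ dist y t + dist t τ₀ := dist_triangle _ _ _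
      _ ≤ ρ / 2 := by linarith
  refine fun x hx => (hUc.subset_of_closure_inter_subset hopen ?_ ?_ hx).1
  · obtain ⟨x, hxU, hxA⟩ := hAU
    exact ⟨x, hxU, hxA, hxU⟩
  · rintro x ⟨hx, hxU⟩
    exact ⟨hA.closure_subset_iff.mpr Set.inter_subset_left hx, hxU⟩

theorem exists_polynomial_line (P : MvPolynomial (Fin 2) ℂ) (p v : ℂ × ℂ) :
    ∃ q : Polynomial ℂ, ∀ τ : ℂ, q.eval τ = evalPair (p + τ • v) P := by
  induction P using MvPolynomial.induction_on with
  | C a => exact ⟨Polynomial.C a, fun τ => by simp⟩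
  | add P Q hP hQ =>
    obtain ⟨q, hq⟩ := hP
    obtain ⟨q', hq'⟩ := hQ
    exact ⟨q + q', fun τ => by simp [hq, hq']⟩
  | mul_X P i hP =>
    obtain ⟨q, hq⟩ := hP
    fin_cases i
    · exact ⟨q * (Polynomial.C p.1 + Polynomial.X * Polynomial.C v.1), fun τ => by
        simp only [map_mul, Polynomial.eval_mul, hq]; simp [mul_comm τ]⟩
    · exact ⟨q * (Polynomial.C p.2 + Polynomial.X * Polynomial.C v.2), fun τ => by
        simp only [map_mul, Polynomial.eval_mul, hq]; simp [mul_comm τ]⟩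

open Filter Topology in
theorem reaches_line (a b : ℂ) (Q : MvPolynomial (Fin 2) ℂ) {K : Set (ℂ × ℂ)} {r θ : ℝ}
    (hθ0 : 0 ≤ θ) (hθ : θ < 1)
    (hK : ∀ x ∈ K, ‖x‖ ≤ r ∧ (‖a * x.1 + b * x.2‖ ≤ θ ∨ evalPair x Q = 0))
    {p : ℂ × ℂ} (hp : a * p.1 + b * p.2 = 1) (hQ : evalPair p Q ≠ 0) {τ : ℂ}
    (hτ : evalPair (p + τ • (b, -a)) Q ≠ 0) : Reaches K p (p + τ • (b, -a)) := by
  obtain ⟨q, hq⟩ := exists_polynomial_line Q p (b, -a)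
  have hq0 : q ≠ 0 := by
    rintro rfl
    exact hτ (by rw [← hq]; simp)
  have hU : {τ : ℂ | evalPair (p + τ • (b, -a)) Q ≠ 0} = ((q.roots.toFinset : Set ℂ))ᶜ := by
    ext τ
    simp only [Set.mem_ofPred_eq, ← hq]
    simp [hq0]
  have hsub : {τ : ℂ | evalPair (p + τ • (b, -a)) Q ≠ 0} ⊆
      {τ : ℂ | Reaches K p (p + τ • (b, -a))} := by
    apply subset_of_approx_moves
    · exact (isClosed_reaches K p).preimage (by fun_prop)
    · rw [hU]; exact (Finset.finite_toSet _).isClosed.isOpen_compl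
    · rw [hU]
      exact ((Finset.countable_toSet _).isConnected_compl_of_one_lt_rank
        (by rw [Complex.rank_real_complex]; norm_num)).isPreconnected
    · exact ⟨0, by simpa only [Set.mem_ofPred_eq, zero_smul, add_zero] using hQ,
        by simpa only [Set.mem_ofPred_eq, zero_smul, add_zero] using Reaches.refl K p⟩
    · rintro τ₀ ⟨hτ₀, hQ₀⟩
      have hl : a * (p + τ₀ • (b, -a)).1 + b * (p + τ₀ • (b, -a)).2 = 1 := by
        rw [← hp]; simp; ring
      obtain ⟨s₀, hs₀, H⟩ := exists_local_push a b Q hθ0 hθ hK hl hQ₀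
      refine ⟨s₀, hs₀, fun s hs => ?_⟩
      have H := H s hs
      choose Θ hΘ hΘK σ hσ hΘσ using fun n : ℕ => H (1 / (n + 1)) Nat.one_div_pos_of_nat
      obtain ⟨σ', hσ', φ, hφ, hlim⟩ := (isCompact_closedBall s (‖s‖ / 4)).tendsto_subseq
        (x := σ) (fun n => by simpa [dist_eq_norm] using hσ n)
      refine ⟨τ₀ + σ', hτ₀.trans (fun x hx => (hK x hx).1) fun ε hε => ?_, ?_⟩
      · have h1 : Tendsto (fun n => 1 / ((φ n : ℝ) + 1)) atTop (𝓝 0) :=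
          tendsto_one_div_add_atTop_nhds_zero_nat.comp hφ.tendsto_atTop
        have h2 : Tendsto (fun n => ‖(σ (φ n) - σ') • ((b, -a) : ℂ × ℂ)‖) atTop (𝓝 0) := by
          have : Tendsto (fun n => ‖((σ ∘ φ) n - σ') • ((b, -a) : ℂ × ℂ)‖) atTop
              (𝓝 ‖(σ' - σ') • ((b, -a) : ℂ × ℂ)‖) :=
            ((hlim.sub_const σ').smul_const _).norm
          simpa using this
        obtain ⟨n, hn1, hn2⟩ := ((h1.eventually (gt_mem_nhds (half_pos hε))).and
          (h2.eventually (gt_mem_nhds (half_pos hε)))).exists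
        refine ⟨Θ (φ n), hΘ _, fun x hx => (hΘK _ x hx).trans (by linarith), ?_⟩
        calc _ = ‖(Θ (φ n) (p + τ₀ • (b, -a)) - (p + τ₀ • (b, -a) + σ (φ n) • (b, -a))) +
                (σ (φ n) - σ') • ((b, -a) : ℂ × ℂ)‖ := by congr 1; module
          _ ≤ ε / 2 + ε / 2 :=
            (norm_add_le _ _).trans (add_le_add ((hΘσ _).trans hn1.le) hn2.le)
          _ = ε := by ring
      · have : ‖σ' - s‖ ≤ ‖s‖ / 4 := by simpa [dist_eq_norm] using hσ'
        calc _ = ‖σ' - s‖ := by congr 1; ring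
          _ ≤ _ := this
  exact hsub hτ

theorem exists_linearForm_eq_one {b : ℂ × ℂ} (hb : b ≠ 0) :
    ∃ c d : ℂ, c * b.1 + d * b.2 = 1 ∧ ‖c‖ + ‖d‖ = 1 / ‖b‖ := by
  have h0 : ‖b‖ ≠ 0 := norm_ne_zero_iff.mpr hb
  rcases max_choice ‖b.1‖ ‖b.2‖ with h | h
  · have hn : ‖b‖ = ‖b.1‖ := h
    have h1 : b.1 ≠ 0 := by rwa [hn, norm_ne_zero_iff] at h0
    exact ⟨1 / b.1, 0, by field_simp; simp, by simp [hn]⟩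
  · have hn : ‖b‖ = ‖b.2‖ := h
    have h1 : b.2 ≠ 0 := by rwa [hn, norm_ne_zero_iff] at h0
    exact ⟨0, 1 / b.2, by field_simp; simp, by simp [hn]⟩

/-- An embedding `z ↦ α (z, 0)` has an extension whose inverse has nonconstant first component
along a given line. -/
theorem exists_extension_nonconstant_on_line {α : Equiv.Perm (ℂ × ℂ)} (hα : α ∈ shearGroup)
    (p : ℂ × ℂ) {v : ℂ × ℂ} (hv : v ≠ 0) :
    ∃ β ∈ shearGroup, (∀ z, β (z, 0) = α (z, 0)) ∧
      ∃ q : Polynomial ℂ, 0 < q.degree ∧ ∀ τ : ℂ, q.eval τ = (β⁻¹ (p + τ • v)).1 := by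
  obtain ⟨P, Q, h⟩ := isPolyMap_of_mem (inv_mem hα)
  obtain ⟨q₁, hq₁⟩ := exists_polynomial_line P p v
  obtain ⟨q₂, hq₂⟩ := exists_polynomial_line Q p v
  by_cases hd : 0 < q₁.degree
  · exact ⟨α, hα, fun _ => rfl, q₁, hd, fun τ => by rw [h, hq₁]⟩
  refine ⟨α * polyShear 0 1 Polynomial.X, mul_mem hα (polyShear_mem _ _ _),
    fun z => by simp [polyShear_apply], q₁ - q₂, ?_, fun τ => ?_⟩
  · by_contra hd'
    rw [not_lt] at hd hd'
    have h1 := Polynomial.eq_C_of_degree_le_zero hd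
    have h2 := Polynomial.eq_C_of_degree_le_zero hd'
    have h3 : q₂ = Polynomial.C (q₁.coeff 0 - (q₁ - q₂).coeff 0) := by
      rw [Polynomial.C_sub, ← h1, ← h2]; ring
    have h4 : α⁻¹ (p + (1 : ℂ) • v) = α⁻¹ (p + (0 : ℂ) • v) := by
      rw [h, h, ← hq₁, ← hq₁, ← hq₂, ← hq₂, h3, h1]
      simp
    have h5 := α⁻¹.injective h4
    simp only [one_smul, zero_smul, add_zero, add_eq_left] at h5
    exact hv h5
  · rw [mul_inv_rev, Equiv.Perm.mul_apply, polyShear_symm_apply, h, Polynomial.eval_sub, hq₁, hq₂]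
    simp

open Filter in
theorem Polynomial.exists_nat_lt_norm_eval {p q : Polynomial ℂ} (hp : 0 < p.degree) (hq : q ≠ 0)
    (M : ℝ) : ∃ n : ℕ, M < ‖p.eval (n : ℂ)‖ ∧ q.eval (n : ℂ) ≠ 0 := by
  have h1 : Tendsto (fun n : ℕ => ‖p.eval (n : ℂ)‖) atTop atTop :=
    p.tendsto_norm_atTop hp (by simpa using tendsto_natCast_atTop_atTop (R := ℝ))
  have h2 : ∀ᶠ n : ℕ in atTop, q.eval (n : ℂ) ≠ 0 := by
    rw [← Nat.cofinite_eq_atTop]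
    have := (q.roots.toFinset.finite_toSet.preimage
      (f := ((↑) : ℕ → ℂ)) Nat.cast_injective.injOn).compl_mem_cofinite
    filter_upwards [this] with n hn
    simpa [hq] using hn
  exact ((h1.eventually_gt_atTop M).and h2).exists

open Filter Topology in
theorem exists_push_along_fibre {β : Equiv.Perm (ℂ × ℂ)} (hβ : β ∈ shearGroup) {K : Set (ℂ × ℂ)}
    {M : ℝ} (hM : ∀ x ∈ K, ‖β⁻¹ x‖ ≤ M) (hM0 : 0 ≤ M) {p : ℂ × ℂ} (hp : M < ‖(β⁻¹ p).1‖)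
    {δ : ℝ} (hδ : 0 < δ) :
    ∃ T ∈ shearGroup, (∀ x ∈ K, ‖T x - x‖ ≤ δ) ∧ T (β ((β⁻¹ p).1, 0)) = p := by
  set w := β⁻¹ p with hw
  have hw0 : 0 < ‖w.1‖ := hM0.trans_lt hp
  obtain ⟨η, hη0, hη⟩ := exists_delta_of_mem hβ M hδ
  have hlim : Tendsto (fun N : ℕ => ‖w.2‖ * (M / ‖w.1‖) ^ N) atTop (𝓝 (‖w.2‖ * 0)) :=
    (tendsto_pow_atTop_nhds_zero_of_lt_one (by positivity) ((div_lt_one hw0).mpr hp)).const_mul _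
  rw [mul_zero] at hlim
  obtain ⟨N, hN⟩ := (hlim.eventually (gt_mem_nhds hη0)).exists
  refine ⟨β * polyShear 1 0 (-(Polynomial.C (w.2 / w.1 ^ N) * Polynomial.X ^ N)) * β⁻¹,
    mul_mem (mul_mem hβ (polyShear_mem _ _ _)) (inv_mem hβ), fun x hx => ?_, ?_⟩
  · have := hη (β⁻¹ x) (polyShear 1 0 (-(Polynomial.C (w.2 / w.1 ^ N) * Polynomial.X ^ N)) (β⁻¹ x))
      (hM x hx) ?_
    · simpa using this
    · have h1 : ‖(β⁻¹ x).1‖ ≤ M := (norm_fst_le _).trans (hM x hx)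
      have h2 : polyShear 1 0 (-(Polynomial.C (w.2 / w.1 ^ N) * Polynomial.X ^ N)) (β⁻¹ x) - β⁻¹ x =
          (0, w.2 / w.1 ^ N * (β⁻¹ x).1 ^ N) := by
        ext <;> simp [polyShear_apply]
      rw [h2]
      calc ‖((0 : ℂ), w.2 / w.1 ^ N * (β⁻¹ x).1 ^ N)‖ = ‖w.2‖ * (‖(β⁻¹ x).1‖ / ‖w.1‖) ^ N := by
            rw [Prod.norm_mk, norm_zero, max_eq_right (norm_nonneg _), norm_mul, norm_div, norm_pow,
              norm_pow, div_pow]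
            ring
        _ ≤ ‖w.2‖ * (M / ‖w.1‖) ^ N := by gcongr
        _ ≤ η := hN.le
  · have h1 : w.1 ^ N ≠ 0 := pow_ne_zero _ (norm_pos_iff.mp hw0)
    have h2 : polyShear 1 0 (-(Polynomial.C (w.2 / w.1 ^ N) * Polynomial.X ^ N)) (w.1, 0) = w := by
      ext
      · simp [polyShear_apply]
      · simp [polyShear_apply, h1]
    simp [h2]
    simp [hw]

theorem exists_approx_step {α : Equiv.Perm (ℂ × ℂ)} (hα : α ∈ shearGroup) {r : ℝ} (hr : 0 ≤ r)
    {b : ℂ × ℂ} (hb : r < ‖b‖) (hbα : ∀ z, α (z, 0) ≠ b) (R : ℝ) {ε : ℝ} (hε : 0 < ε) :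
    ∃ Φ ∈ shearGroup, (∀ x, ‖x‖ ≤ r → ‖Φ x - x‖ ≤ ε) ∧
      (∀ z, ‖z‖ ≤ R → ‖Φ (α (z, 0)) - α (z, 0)‖ ≤ ε) ∧ ∃ ζ, ‖Φ (α (ζ, 0)) - b‖ ≤ ε := by
  have hb0 : 0 < ‖b‖ := hr.trans_lt hb
  obtain ⟨c, d, hcd, hcd'⟩ := exists_linearForm_eq_one (norm_pos_iff.mp hb0)
  have hv : (d, -c) ≠ (0 : ℂ × ℂ) := by
    intro h
    rw [Prod.ext_iff] at h
    simp only [Prod.fst_zero, Prod.snd_zero, neg_eq_zero] at h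
    simp [h.1, h.2] at hcd
  obtain ⟨β, hβ, hβα, q, hqd, hq⟩ := exists_extension_nonconstant_on_line hα b hv
  simp only [← hβα] at hbα ⊢
  obtain ⟨P, Q, hPQ⟩ := isPolyMap_of_mem (inv_mem hβ)
  obtain ⟨q₂, hq₂⟩ := exists_polynomial_line Q b (d, -c)
  have hQb : evalPair b Q ≠ 0 := fun h => by
    have h1 := hPQ b
    rw [h] at h1
    exact hbα (evalPair b P) (by rw [← h1]; simp)
  have hq₂0 : q₂ ≠ 0 := by
    rintro rfl
    have := hq₂ 0
    rw [zero_smul, add_zero] at this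
    exact hQb (by simpa using this.symm)
  obtain ⟨D, hD0, hD⟩ := (continuous_of_mem hβ).exists_bound_closedBall R
  obtain ⟨D', hD'0, hD'⟩ := (continuous_of_mem (inv_mem hβ)).exists_bound_closedBall r
  have hD (z : ℂ) (hz : ‖z‖ ≤ R) : ‖β (z, 0)‖ ≤ D := hD _ (by simpa using hz)
  set K : Set (ℂ × ℂ) := {x | ‖x‖ ≤ r ∨ ∃ z : ℂ, ‖z‖ ≤ R ∧ β (z, 0) = x} with hK
  obtain ⟨n, hnM, hnQ⟩ := Polynomial.exists_nat_lt_norm_eval hqd hq₂0 (max D' R)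
  rw [hq] at hnM
  rw [hq₂] at hnQ
  set p := b + (n : ℂ) • (d, -c) with hp
  have hKr : ∀ x ∈ K, ‖x‖ ≤ max r D := by
    rintro x (hx | ⟨z, hz, rfl⟩)
    exacts [hx.trans (le_max_left _ _), (hD z hz).trans (le_max_right _ _)]
  have hpb : p + (-n : ℂ) • (d, -c) = b := by rw [hp]; module
  have hreach : Reaches K p b := by
    rw [← hpb]
    refine reaches_line c d Q (θ := r / ‖b‖) (by positivity) ((div_lt_one hb0).mpr hb)
      (r := max r D) (fun x hx => ⟨hKr x hx, ?_⟩) ?_ hnQ (by rwa [hpb])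
    · rcases hx with hx | ⟨z, hz, rfl⟩
      · left
        refine (norm_linearForm_le c d x).trans ?_
        rw [hcd', one_div, div_eq_inv_mul]
        gcongr
      · right
        exact congrArg Prod.snd ((hPQ (β (z, 0))).symm.trans (β.symm_apply_apply _))
    · rw [← hcd]; simp [hp]; ring
  obtain ⟨Θ, hΘ, hΘK, hΘp⟩ := hreach (ε / 2) (half_pos hε)
  obtain ⟨δ, hδ0, hδ⟩ := exists_delta_of_mem hΘ (max r D) (half_pos hε)
  obtain ⟨T, hT, hTK, hTp⟩ := exists_push_along_fibre hβ (K := K) (M := max D' R) (fun x hx => by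
    rcases hx with hx | ⟨z, hz, rfl⟩
    · exact (hD' x hx).trans (le_max_left _ _)
    · simpa using Or.inr hz) (le_max_of_le_left hD'0) hnM hδ0
  have key : ∀ x ∈ K, ‖(Θ * T) x - x‖ ≤ ε := fun x hx => by
    calc ‖(Θ * T) x - x‖ = ‖(Θ (T x) - Θ x) + (Θ x - x)‖ := by simp
      _ ≤ ε / 2 + ε / 2 :=
        (norm_add_le _ _).trans (add_le_add (hδ x _ (hKr x hx) (hTK x hx)) (hΘK x hx))
      _ = ε := by ring
  refine ⟨Θ * T, mul_mem hΘ hT, fun x hx => key x (Or.inl hx),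
    fun z hz => key _ (Or.inr ⟨z, hz, rfl⟩), (β⁻¹ p).1, ?_⟩
  rw [Equiv.Perm.mul_apply, hTp]
  exact hΘp.trans (by linarith)

theorem Finset.exists_pos_forall_le {ι : Type*} (s : Finset ι) (f : ι → ℝ) (hf : ∀ i ∈ s, 0 < f i) :
    ∃ σ > 0, ∀ i ∈ s, σ ≤ f i := by
  have h : ∀ᶠ σ in nhdsWithin (0 : ℝ) (Set.Ioi 0), ∀ i ∈ s, σ ≤ f i :=
    (Finset.eventually_all s).2 fun i hi =>
      (Filter.Eventually.filter_mono nhdsWithin_le_nhds (gt_mem_nhds (hf i hi))).mono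
        fun _ h => h.le
  obtain ⟨σ, hσ, h0⟩ := (h.and self_mem_nhdsWithin).exists
  exact ⟨σ, h0, hσ⟩

theorem Lagrange.exists_delta_norm_interpolate_le {ι : Type*} [DecidableEq ι] (S : Finset ι)
    {σ : ℝ} (hσ : 0 < σ) {M : ℝ} (hM : 0 ≤ M) {ε : ℝ} (hε : 0 < ε) :
    ∃ δ > 0, ∀ v w : ι → ℂ, (∀ i ∈ S, ‖v i‖ ≤ M) →
      (∀ i ∈ S, ∀ j ∈ S, i ≠ j → σ ≤ ‖v i - v j‖) → (∀ i ∈ S, ‖w i‖ ≤ δ) →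
      ∃ p : Polynomial ℂ, (∀ i ∈ S, p.eval (v i) = w i) ∧ ∀ t, ‖t‖ ≤ M → ‖p.eval t‖ ≤ ε := by
  set A : ℝ := max 1 (2 * M / σ) ^ S.card
  have hA : 0 < A := by positivity
  refine ⟨ε / (S.card * A + 1), by positivity, fun v w hv hsep hw =>
    ⟨Lagrange.interpolate S v w, fun i hi => ?_, fun t ht => ?_⟩⟩
  · refine Lagrange.eval_interpolate_at_node w (fun i hi j hj hij => ?_) hi
    by_contra hne
    have := hsep i hi j hj hne
    rw [hij, sub_self, norm_zero] at this
    linarith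
  · have hbasis : ∀ i ∈ S, ‖(Lagrange.basis S v i).eval t‖ ≤ A := fun i hi => by
      rw [Lagrange.basis, Polynomial.eval_prod, norm_prod]
      calc ∏ j ∈ S.erase i, ‖(Lagrange.basisDivisor (v i) (v j)).eval t‖
          ≤ ∏ j ∈ S.erase i, max 1 (2 * M / σ) := by
            refine Finset.prod_le_prod (fun _ _ => norm_nonneg _) fun j hj => ?_
            rw [Finset.mem_erase] at hj
            refine le_max_of_le_right ?_
            have h1 := hsep i hi j hj.2 hj.1.symm
            have h2 : ‖t - v j‖ ≤ 2 * M := (norm_sub_le _ _).trans (by linarith [hv j hj.2])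
            rw [Lagrange.basisDivisor, Polynomial.eval_mul, norm_mul, Polynomial.eval_C, norm_inv,
              Polynomial.eval_sub, Polynomial.eval_X, Polynomial.eval_C, inv_mul_eq_div]
            gcongr
        _ ≤ A := by
            rw [Finset.prod_const]
            exact pow_le_pow_right₀ (le_max_left _ _)
              (Finset.card_le_card (Finset.erase_subset _ _))
    rw [Lagrange.interpolate_apply, Polynomial.eval_finsetSum]
    calc _ ≤ ∑ i ∈ S, ε / (S.card * A + 1) * A := by
          refine norm_sum_le_of_le _ fun i hi => ?_
          rw [Polynomial.eval_mul, norm_mul, Polynomial.eval_C]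
          gcongr
          exacts [hw i hi, hbasis i hi]
      _ = ε * (S.card * A / (S.card * A + 1)) := by
          rw [Finset.sum_const, nsmul_eq_mul]; ring
      _ ≤ ε := by
          refine mul_le_of_le_one_right hε.le ((div_le_one (by positivity)).mpr (by linarith))

theorem exists_linearForm_injOn (S : Finset (ℂ × ℂ)) (T : Finset ℂ) :
    ∃ t ∉ T, Set.InjOn (fun x : ℂ × ℂ => x.1 + t * x.2) S := by
  classical
  obtain ⟨t, ht⟩ := Infinite.exists_notMem_finset
    (T ∪ S.offDiag.image fun x => -(x.1.1 - x.2.1) / (x.1.2 - x.2.2))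
  rw [Finset.mem_union, not_or] at ht
  refine ⟨t, ht.1, fun x hx y hy hxy => ?_⟩
  simp only at hxy
  by_contra hne
  refine ht.2 (Finset.mem_image.mpr ⟨(x, y), by simpa using ⟨hx, hy, hne⟩, ?_⟩)
  have h2 : x.2 - y.2 ≠ 0 := fun h => hne <| by
    have h' := sub_eq_zero.mp h
    rw [h'] at hxy
    exact Prod.ext (add_right_cancel hxy) h'
  rw [div_eq_iff h2]
  linear_combination -hxy

theorem norm_polyShear_sub_le (t : ℂ) (p : Polynomial ℂ) (x : ℂ × ℂ) :
    ‖polyShear 1 t p x - x‖ ≤ (1 + ‖t‖) * ‖p.eval (x.1 + t * x.2)‖ := by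
  have h : polyShear 1 t p x - x = p.eval (x.1 + t * x.2) • ((t, -1) : ℂ × ℂ) := by
    ext
    · simp [polyShear_apply]; ring
    · simp [polyShear_apply]
  rw [h, norm_smul, mul_comm]
  gcongr
  rw [Prod.norm_mk, norm_neg, norm_one]
  exact max_le (by linarith) (by linarith [norm_nonneg t])

theorem exists_correction (S : Finset (ℂ × ℂ)) (r : ℝ) {ε : ℝ} (hε : 0 < ε) :
    ∃ δ > 0, ∀ g : ℂ × ℂ → ℂ × ℂ, (∀ s ∈ S, ‖g s - s‖ ≤ δ) →
      ∃ C ∈ shearGroup, (∀ s ∈ S, C (g s) = s) ∧ ∀ x, ‖x‖ ≤ r → ‖C x - x‖ ≤ ε := by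
  classical
  obtain ⟨t₁, -, ht₁⟩ := exists_linearForm_injOn S ∅
  obtain ⟨t₂, h_ne, ht₂⟩ := exists_linearForm_injOn S {t₁}
  rw [Finset.mem_singleton] at h_ne
  have hsub : 0 < ‖t₁ - t₂‖ := norm_pos_iff.mpr (sub_ne_zero.mpr (Ne.symm h_ne))
  obtain ⟨σ, hσ0, hσ⟩ := S.offDiag.exists_pos_forall_le
    (fun x => min ‖(x.1.1 + t₁ * x.1.2) - (x.2.1 + t₁ * x.2.2)‖
      ‖(x.1.1 + t₂ * x.1.2) - (x.2.1 + t₂ * x.2.2)‖) (fun x hx => by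
        rw [Finset.mem_offDiag] at hx
        exact lt_min (norm_pos_iff.mpr (sub_ne_zero.mpr (ht₁.ne hx.1 hx.2.1 hx.2.2)))
          (norm_pos_iff.mpr (sub_ne_zero.mpr (ht₂.ne hx.1 hx.2.1 hx.2.2))))
  obtain ⟨R, hR0, hRr, hRS⟩ : ∃ R : ℝ, 0 ≤ R ∧ r ≤ R ∧ ∀ s ∈ S, ‖s‖ ≤ R := by
    obtain ⟨R, hR⟩ := S.finite_toSet.isBounded.exists_norm_le
    exact ⟨max 0 (max r R), le_max_left _ _, by simp, fun s hs => (hR s hs).trans (by simp)⟩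
  set L : ℝ := 1 + ‖t₁‖ + ‖t₂‖ with hL
  have hL0 : 0 < L := by positivity
  have hL₁ : 1 + ‖t₁‖ ≤ L := by linarith [norm_nonneg t₂]
  have hL₂ : 1 + ‖t₂‖ ≤ L := by linarith [norm_nonneg t₁]
  have hform (t : ℂ) (ht : 1 + ‖t‖ ≤ L) (x : ℂ × ℂ) {B : ℝ} (hx : ‖x‖ ≤ B) :
      ‖x.1 + t * x.2‖ ≤ L * B := by
    have := norm_linearForm_le 1 t x
    rw [one_mul, norm_one] at this
    exact this.trans (by gcongr)
  obtain ⟨η, hη0, hη⟩ := Lagrange.exists_delta_norm_interpolate_le S (half_pos hσ0)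
    (M := L * (R + 1)) (by positivity) (ε := min ε 1 / (2 * L)) (by positivity)
  refine ⟨min 1 (min (σ / (4 * L)) (η * ‖t₁ - t₂‖ / L)), by positivity, fun g hg => ?_⟩
  have hg1 : ∀ s ∈ S, ‖g s - s‖ ≤ 1 := fun s hs => (hg s hs).trans (min_le_left _ _)
  have hg2 : ∀ s ∈ S, ‖g s - s‖ ≤ σ / (4 * L) := fun s hs =>
    (hg s hs).trans ((min_le_right _ _).trans (min_le_left _ _))
  have hg3 : ∀ s ∈ S, ‖g s - s‖ ≤ η * ‖t₁ - t₂‖ / L := fun s hs =>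
    (hg s hs).trans ((min_le_right _ _).trans (min_le_right _ _))
  have hvalue (t u : ℂ) (ht : 1 + ‖t‖ ≤ L) (hu : ‖u‖ = ‖t₁ - t₂‖) (s : ℂ × ℂ) (hs : s ∈ S) :
      ‖((s.1 + t * s.2) - ((g s).1 + t * (g s).2)) / u‖ ≤ η := by
    have h1 := hform t ht (g s - s) (hg3 s hs)
    rw [norm_div, hu, div_le_iff₀ hsub, norm_sub_rev]
    calc _ = ‖(g s - s).1 + t * (g s - s).2‖ := by congr 1; simp; ring
      _ ≤ _ := h1
      _ = _ := by field_simp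
  obtain ⟨p₁, hp₁, hp₁'⟩ := hη (fun s => (g s).1 + t₁ * (g s).2)
    (fun s => ((s.1 + t₂ * s.2) - ((g s).1 + t₂ * (g s).2)) / (t₁ - t₂))
    (fun s hs => hform t₁ hL₁ _ (by
      calc ‖g s‖ = ‖s + (g s - s)‖ := by simp
        _ ≤ R + 1 := (norm_add_le _ _).trans (add_le_add (hRS s hs) (hg1 s hs))))
    (fun s hs s' hs' hne => by
      have h1 := (hσ (s, s') (Finset.mem_offDiag.mpr ⟨hs, hs', hne⟩)).trans (min_le_left _ _)
      have h2 := hform t₁ hL₁ _ (hg2 s hs)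
      have h3 := hform t₁ hL₁ _ (hg2 s' hs')
      have h4 : L * (σ / (4 * L)) = σ / 4 := by field_simp
      rw [h4] at h2 h3
      have h5 : (s.1 + t₁ * s.2) - (s'.1 + t₁ * s'.2) =
          ((g s).1 + t₁ * (g s).2 - ((g s').1 + t₁ * (g s').2)) -
          (((g s - s).1 + t₁ * (g s - s).2) - ((g s' - s').1 + t₁ * (g s' - s').2)) := by
        simp; ring
      simp only at h1
      rw [h5] at h1
      have h6 := norm_sub_le ((g s).1 + t₁ * (g s).2 - ((g s').1 + t₁ * (g s').2))
        (((g s - s).1 + t₁ * (g s - s).2) - ((g s' - s').1 + t₁ * (g s' - s').2))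
      have h7 := norm_sub_le ((g s - s).1 + t₁ * (g s - s).2) ((g s' - s').1 + t₁ * (g s' - s').2)
      linarith)
    (hvalue t₂ _ hL₂ rfl)
  obtain ⟨p₂, hp₂, hp₂'⟩ := hη (fun s => s.1 + t₂ * s.2)
    (fun s => ((s.1 + t₁ * s.2) - ((g s).1 + t₁ * (g s).2)) / (t₂ - t₁))
    (fun s hs => hform t₂ hL₂ _ ((hRS s hs).trans (by linarith)))
    (fun s hs s' hs' hne => by
      have h1 := (hσ (s, s') (Finset.mem_offDiag.mpr ⟨hs, hs', hne⟩)).trans (min_le_right _ _)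
      exact le_trans (by linarith) h1)
    (hvalue t₁ _ hL₁ (norm_sub_rev _ _))
  refine ⟨polyShear 1 t₂ p₂ * polyShear 1 t₁ p₁,
    mul_mem (polyShear_mem _ _ _) (polyShear_mem _ _ _),
    fun s hs => ?_, fun x hx => ?_⟩
  · have h12 : t₁ - t₂ ≠ 0 := norm_pos_iff.mp hsub
    have h21 : t₂ - t₁ ≠ 0 := sub_ne_zero.mpr h_ne
    have e1 := hp₁ s hs
    have e2 := hp₂ s hs
    rw [eq_div_iff h12] at e1
    rw [eq_div_iff h21] at e2
    have e3 : (polyShear 1 t₁ p₁ (g s)).1 + t₂ * (polyShear 1 t₁ p₁ (g s)).2 = s.1 + t₂ * s.2 := by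
      simp only [polyShear_apply, one_mul]
      linear_combination e1
    have e4 : (polyShear 1 t₂ p₂ * polyShear 1 t₁ p₁) (g s) =
        ((polyShear 1 t₁ p₁ (g s)).1 + t₂ * p₂.eval (s.1 + t₂ * s.2),
          (polyShear 1 t₁ p₁ (g s)).2 - p₂.eval (s.1 + t₂ * s.2)) := by
      rw [Equiv.Perm.mul_apply, polyShear_apply, one_mul, e3, one_mul]
    have e5 : ((polyShear 1 t₂ p₂ * polyShear 1 t₁ p₁) (g s)).2 = s.2 := by
      rw [e4]
      simp only [polyShear_apply, one_mul] at e3 ⊢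
      refine mul_left_cancel₀ h21 ?_
      linear_combination e3 - e2
    have e6 : ((polyShear 1 t₂ p₂ * polyShear 1 t₁ p₁) (g s)).1 = s.1 := by
      rw [e4] at e5 ⊢
      simp only at e5 ⊢
      linear_combination e3 - t₂ * e5
    exact Prod.ext e6 e5
  · have hL2 : L * (min ε 1 / (2 * L)) = min ε 1 / 2 := by field_simp
    have h1 : ‖polyShear 1 t₁ p₁ x - x‖ ≤ min ε 1 / 2 := by
      rw [← hL2]
      refine (norm_polyShear_sub_le _ _ _).trans ?_
      gcongr
      exact hp₁' _ (hform t₁ hL₁ _ (by linarith))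
    have h2 : ‖polyShear 1 t₁ p₁ x‖ ≤ R + 1 := by
      calc _ = ‖x + (polyShear 1 t₁ p₁ x - x)‖ := by simp
        _ ≤ r + min ε 1 / 2 := (norm_add_le _ _).trans (add_le_add hx h1)
        _ ≤ R + 1 := by linarith [min_le_right ε 1]
    have h3 : ‖polyShear 1 t₂ p₂ (polyShear 1 t₁ p₁ x) - polyShear 1 t₁ p₁ x‖ ≤ min ε 1 / 2 := by
      rw [← hL2]
      refine (norm_polyShear_sub_le _ _ _).trans ?_
      gcongr
      exact hp₂' _ (hform t₂ hL₂ _ h2)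
    calc _ = ‖(polyShear 1 t₂ p₂ (polyShear 1 t₁ p₁ x) - polyShear 1 t₁ p₁ x) +
          (polyShear 1 t₁ p₁ x - x)‖ := by simp
      _ ≤ min ε 1 / 2 + min ε 1 / 2 := (norm_add_le _ _).trans (add_le_add h3 h1)
      _ ≤ ε := by linarith [min_le_left ε 1]

theorem exists_step {α : Equiv.Perm (ℂ × ℂ)} (hα : α ∈ shearGroup) {r : ℝ} (hr : 0 ≤ r) (R : ℝ)
    {ε : ℝ} (hε : 0 < ε) (S : Finset (ℂ × ℂ)) {b : ℂ × ℂ} (hb : r < ‖b‖ ∨ ∃ z, α (z, 0) = b) :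
    ∃ Φ ∈ shearGroup, (∀ x, ‖x‖ ≤ r → ‖Φ x - x‖ ≤ ε) ∧
      (∀ z, ‖z‖ ≤ R → ‖Φ (α (z, 0)) - α (z, 0)‖ ≤ ε) ∧
      (∀ z, α (z, 0) ∈ S → Φ (α (z, 0)) = α (z, 0)) ∧ ∃ ζ, Φ (α (ζ, 0)) = b := by
  classical
  by_cases hbα : ∃ z, α (z, 0) = b
  · exact ⟨1, one_mem _, fun x _ => by simpa using hε.le, fun x _ => by simpa using hε.le,
      fun _ _ => rfl, hbα⟩
  replace hb := hb.resolve_right hbα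
  rw [not_exists] at hbα
  have hinj : Function.Injective fun z : ℂ => α (z, 0) :=
    α.injective.comp (Prod.mk_left_injective 0)
  obtain ⟨R', hRR', hR'⟩ : ∃ R', R ≤ R' ∧ ∀ z, α (z, 0) ∈ S → ‖z‖ ≤ R' := by
    obtain ⟨R', h⟩ := (S.finite_toSet.preimage hinj.injOn).isBounded.exists_norm_le
    exact ⟨max R R', le_max_left _ _, fun z hz => (h z hz).trans (le_max_right _ _)⟩
  obtain ⟨D, hD0, hD⟩ := (continuous_of_mem hα).exists_bound_closedBall R'
  obtain ⟨δ, hδ0, hδ⟩ := exists_correction (insert b (S.filter fun s => ∃ z, α (z, 0) = s))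
    (max r D + 1) (half_pos hε)
  obtain ⟨Φ, hΦ, hΦr, hΦR, ζ, hζ⟩ := exists_approx_step hα hr hb hbα R'
    (ε := min δ (min 1 (ε / 2))) (by positivity)
  obtain ⟨C, hC, hCS, hCr⟩ := hδ (fun x => if x = b then Φ (α (ζ, 0)) else Φ x) (by
    intro s hs
    rcases Finset.mem_insert.mp hs with rfl | hs
    · simpa using hζ.trans (min_le_left _ _)
    · obtain ⟨hs, z, rfl⟩ := Finset.mem_filter.mp hs
      simpa [hbα z] using (hΦR z (hR' z hs)).trans (min_le_left _ _))
  have key (x : ℂ × ℂ) (hx : ‖x‖ ≤ max r D) (h : ‖Φ x - x‖ ≤ min δ (min 1 (ε / 2))) :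
      ‖(C * Φ) x - x‖ ≤ ε := by
    have h1 : ‖Φ x - x‖ ≤ 1 := h.trans ((min_le_right _ _).trans (min_le_left _ _))
    have h2 : ‖Φ x - x‖ ≤ ε / 2 := h.trans ((min_le_right _ _).trans (min_le_right _ _))
    have h3 : ‖Φ x‖ ≤ max r D + 1 := by
      calc ‖Φ x‖ = ‖x + (Φ x - x)‖ := by simp
        _ ≤ _ := (norm_add_le _ _).trans (add_le_add hx h1)
    calc ‖(C * Φ) x - x‖ = ‖(C (Φ x) - Φ x) + (Φ x - x)‖ := by simp
      _ ≤ ε / 2 + ε / 2 := (norm_add_le _ _).trans (add_le_add (hCr _ h3) h2)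
      _ = ε := by ring
  refine ⟨C * Φ, mul_mem hC hΦ, fun x hx => key x (hx.trans (le_max_left _ _)) (hΦr x hx),
    fun z hz => key _ (le_max_of_le_right (hD _ (by simpa using hz.trans hRR')))
      (hΦR z (hz.trans hRR')), fun z hz => ?_, ζ, ?_⟩
  · have := hCS (α (z, 0)) (Finset.mem_insert_of_mem (Finset.mem_filter.mpr ⟨hz, z, rfl⟩))
    simpa [hbα z] using this
  · simpa using hCS b (Finset.mem_insert_self _ _)

/-- A homeomorphism of `ℂ²` close to the identity on a ball does not move points from outside the
ball deep into it. -/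
theorem le_norm_apply_of_near_id {Φ : Equiv.Perm (ℂ × ℂ)} (hΦ : Φ ∈ shearGroup) {r ε : ℝ}
    (hε : ε ≤ 1 / 2) (h : ∀ x, ‖x‖ ≤ r → ‖Φ x - x‖ ≤ ε) {y : ℂ × ℂ} (hy : r < ‖y‖) :
    r - 1 ≤ ‖Φ y‖ := by
  by_contra! hlt
  have hr : 1 < r := by linarith [norm_nonneg (Φ y)]
  have hcont : Continuous Φ.symm := continuous_of_mem (inv_mem hΦ)
  have hsub : Metric.ball 0 (r - ε) ⊆ Φ.symm ⁻¹' Metric.ball 0 r := by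
    refine (convex_ball _ _).isPreconnected.subset_of_closure_inter_subset
      (Metric.isOpen_ball.preimage hcont) ⟨Φ 0, ?_, ?_⟩ ?_
    · have := h 0 (by rw [norm_zero]; linarith)
      rw [sub_zero] at this
      rw [mem_ball_zero_iff]
      linarith
    · simp only [Set.mem_preimage, mem_ball_zero_iff, Equiv.symm_apply_apply, norm_zero]
      linarith
    · rintro x ⟨hx, hxr⟩
      have hx' : x ∈ Φ.symm ⁻¹' Metric.closedBall 0 r :=
        closure_minimal (Set.preimage_mono Metric.ball_subset_closedBall)
          (Metric.isClosed_closedBall.preimage hcont) hx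
      simp only [Set.mem_preimage, mem_ball_zero_iff, mem_closedBall_zero_iff] at hx' hxr ⊢
      refine lt_of_le_of_ne hx' fun heq => ?_
      have h1 := h _ heq.le
      rw [Equiv.apply_symm_apply] at h1
      have h2 := norm_sub_norm_le (Φ.symm x) x
      rw [norm_sub_rev] at h2
      linarith
  have := hsub (mem_ball_zero_iff.mpr (show ‖Φ y‖ < r - ε by linarith))
  simp only [Set.mem_preimage, mem_ball_zero_iff, Equiv.symm_apply_apply] at this
  linarith

theorem exists_le_norm_sub_of_mem {α : Equiv.Perm (ℂ × ℂ)} (hα : α ∈ shearGroup) (ρ : ℝ) :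
    ∃ c > 0, ∀ z w : ℂ, ‖z‖ ≤ ρ → ‖w‖ ≤ ρ → c * ‖z - w‖ ≤ ‖α (z, 0) - α (w, 0)‖ := by
  obtain ⟨D, -, hD⟩ := (continuous_of_mem hα).exists_bound_closedBall ρ
  obtain ⟨Λ, hΛ0, hΛ⟩ := (contDiff_of_mem (inv_mem hα)).exists_lipschitz_closedBall D
  refine ⟨1 / (Λ + 1), by positivity, fun z w hz hw => ?_⟩
  have h1 := hΛ _ _ (hD (z, 0) (by simpa using hz)) (hD (w, 0) (by simpa using hw))
  rw [Equiv.Perm.inv_def, Equiv.symm_apply_apply, Equiv.symm_apply_apply] at h1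
  have h2 : ‖z - w‖ ≤ ‖((z, 0) : ℂ × ℂ) - (w, 0)‖ := norm_fst_le (((z, 0) : ℂ × ℂ) - (w, 0))
  rw [one_div, inv_mul_le_iff₀ (by positivity)]
  nlinarith [norm_nonneg (α (z, 0) - α (w, 0))]

theorem exists_lt_norm_of_mem {α : Equiv.Perm (ℂ × ℂ)} (hα : α ∈ shearGroup) (M : ℝ) :
    ∃ ρ : ℝ, ∀ z : ℂ, ρ ≤ ‖z‖ → M < ‖α (z, 0)‖ := by
  obtain ⟨D, -, hD⟩ := (continuous_of_mem (inv_mem hα)).exists_bound_closedBall M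
  refine ⟨D + 1, fun z hz => ?_⟩
  by_contra! h
  have h1 := hD _ h
  rw [Equiv.Perm.inv_def, Equiv.symm_apply_apply] at h1
  linarith [norm_fst_le ((z, 0) : ℂ × ℂ)]

open Filter Topology in
/-- A limit procedure producing properly embedded lines. -/
theorem exists_properly_embedded_limit {E : Type*} [NormedAddCommGroup E] [NormedSpace ℂ E]
    [CompleteSpace E] {f : ℕ → ℂ → E} {ρ ε r : ℕ → ℝ} (hf : ∀ n, Differentiable ℂ (f n))
    (hρn : ∀ n : ℕ, n ≤ ρ n) (hρ : ∀ n, ρ n ≤ ρ (n + 1)) (hε0 : ∀ n, 0 < ε n) (hε1 : ∀ n, ε n ≤ 1)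
    (hε : ∀ n, ε (n + 1) ≤ ε n / 2)
    (hsep : ∀ n z w, ‖z‖ ≤ ρ n → ‖w‖ ≤ ρ n → 2 * ε n * ‖z - w‖ ≤ ‖f n z - f n w‖)
    (hclose : ∀ n z, ‖z‖ ≤ ρ n + 1 → ‖f (n + 1) z - f n z‖ ≤ ε n / 2)
    (hproper : ∀ n z, ρ n ≤ ‖z‖ → r n ≤ ‖f (n + 1) z‖) (hr : Tendsto r atTop atTop) :
    ∃ F : ℂ → E, Differentiable ℂ F ∧ Function.Injective F ∧ (∀ z, deriv F z ≠ 0) ∧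
      (∀ M : ℝ, ∃ R : ℝ, ∀ z, R ≤ ‖z‖ → M ≤ ‖F z‖) ∧
      ∀ z, Tendsto (fun n => f n z) atTop (𝓝 (F z)) := by
  have hρm : Monotone ρ := monotone_nat_of_le_succ hρ
  have hεlim : Tendsto ε atTop (𝓝 0) := by
    have h (n : ℕ) : ε n ≤ (1 / 2) ^ n := by
      induction n with
      | zero => simpa using hε1 0
      | succ n ih => rw [pow_succ]; linarith [hε n]
    exact squeeze_zero (fun n => (hε0 n).le) h
      (tendsto_pow_atTop_nhds_zero_of_lt_one (by norm_num) (by norm_num))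
  have hstep (n m : ℕ) (hnm : n ≤ m) (z : ℂ) (hz : ‖z‖ ≤ ρ n + 1) :
      ‖f m z - f n z‖ ≤ ε n - ε m := by
    induction m, hnm using Nat.le_induction with
    | base => simp
    | succ m hnm ih =>
      have h1 := hclose m z (hz.trans (by linarith [hρm hnm]))
      have h2 := norm_sub_le_norm_sub_add_norm_sub (f (m + 1) z) (f m z) (f n z)
      linarith [hε m]
  have hlim (z : ℂ) : ∃ y, Tendsto (fun n => f n z) atTop (𝓝 y) := by
    obtain ⟨N, hN⟩ := exists_nat_ge ‖z‖
    have hc : CauchySeq fun n => f (n + N) z := by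
      refine cauchySeq_of_le_tendsto_0' (fun n => ε (n + N)) (fun n m hnm => ?_)
        (hεlim.comp (tendsto_add_atTop_nat N))
      rw [dist_comm, dist_eq_norm]
      have h1 : ‖z‖ ≤ ρ (n + N) + 1 := by
        have := hρn (n + N)
        push_cast at this
        have h0 : (0 : ℝ) ≤ n := n.cast_nonneg
        linarith
      linarith [hstep (n + N) (m + N) (by omega) z h1, hε0 (m + N)]
    obtain ⟨y, hy⟩ := cauchySeq_tendsto_of_complete hc
    exact ⟨y, (tendsto_add_atTop_iff_nat N).mp hy⟩
  choose F hF using hlim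
  have hFn (n : ℕ) (z : ℂ) (hz : ‖z‖ ≤ ρ n + 1) : ‖F z - f n z‖ ≤ ε n := by
    refine le_of_tendsto ((hF z).sub_const (f n z)).norm ?_
    filter_upwards [eventually_ge_atTop n] with m hm
    linarith [hstep n m hm z hz, hε0 m]
  have hdiff : Differentiable ℂ F := fun z => by
    obtain ⟨N, hN⟩ := exists_nat_ge ‖z‖
    have hu : TendstoUniformlyOn f F atTop (Metric.ball 0 (ρ N + 1)) := by
      rw [Metric.tendstoUniformlyOn_iff]
      intro η hη
      filter_upwards [eventually_ge_atTop N, hεlim.eventually (gt_mem_nhds hη)] with n hn hnη x hx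
      rw [mem_ball_zero_iff] at hx
      rw [dist_eq_norm]
      exact (hFn n x (by linarith [hρm hn])).trans_lt hnη
    exact (hu.tendstoLocallyUniformlyOn.differentiableOn
      (Eventually.of_forall fun n => (hf n).differentiableOn) Metric.isOpen_ball).differentiableAt
      (Metric.isOpen_ball.mem_nhds (mem_ball_zero_iff.mpr (by linarith [hρn N])))
  have hsepF (n : ℕ) (z w : ℂ) (hz : ‖z‖ ≤ ρ n) (hw : ‖w‖ ≤ ρ n) :
      ε n * ‖z - w‖ ≤ ‖F z - F w‖ := by
    have hg : Differentiable ℂ fun z => F z - f n z := hdiff.sub (hf n)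
    have hd (x : ℂ) (hx : x ∈ Metric.closedBall 0 (ρ n)) :
        ‖deriv (fun z => F z - f n z) x‖ ≤ ε n := by
      rw [mem_closedBall_zero_iff] at hx
      have := Complex.norm_deriv_le_of_forall_mem_sphere_norm_le one_pos
        (hg.diffContOnCl (s := Metric.ball x 1)) (C := ε n) fun y hy => hFn n y (by
          have h1 : ‖y - x‖ = 1 := by rwa [mem_sphere_iff_norm] at hy
          calc ‖y‖ = ‖x + (y - x)‖ := by simp
            _ ≤ _ := (norm_add_le _ _).trans (by rw [h1]; linarith))
      simpa using this
    have h1 := (convex_closedBall (0 : ℂ) (ρ n)).norm_image_sub_le_of_norm_deriv_le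
      (fun x _ => hg x) hd (mem_closedBall_zero_iff.mpr hw) (mem_closedBall_zero_iff.mpr hz)
    have h2 := hsep n z w hz hw
    have h3 : f n z - f n w = (F z - F w) - ((F z - f n z) - (F w - f n w)) := by abel
    rw [h3] at h2
    have h4 := h2.trans (norm_sub_le _ _)
    linarith
  refine ⟨F, hdiff, fun z w hzw => ?_, fun z hz => ?_, fun M => ?_, hF⟩
  · obtain ⟨N, hN⟩ := exists_nat_ge (max ‖z‖ ‖w‖)
    have h1 := hsepF N z w ((le_max_left _ _).trans (hN.trans (hρn N)))
      ((le_max_right _ _).trans (hN.trans (hρn N)))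
    rw [hzw, sub_self, norm_zero] at h1
    have h2 : ‖z - w‖ = 0 := by nlinarith [norm_nonneg (z - w), hε0 N]
    exact sub_eq_zero.mp (norm_eq_zero.mp h2)
  · obtain ⟨N, hN⟩ := exists_nat_gt ‖z‖
    have h1 := (hasDerivAt_iff_tendsto_slope.mp (hdiff z).hasDerivAt).norm
    rw [hz, norm_zero] at h1
    have h2 : ∀ᶠ w in 𝓝[≠] z, ε N ≤ ‖slope F z w‖ := by
      have h3 : ∀ᶠ w in 𝓝[≠] z, ‖w‖ < N :=
        (continuous_norm.tendsto z).eventually (gt_mem_nhds hN) |>.filter_mono nhdsWithin_le_nhds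
      filter_upwards [h3, self_mem_nhdsWithin] with w hw hwz
      have h4 := hsepF N w z (hw.le.trans (hρn N)) (hN.le.trans (hρn N))
      have h5 : 0 < ‖w - z‖ := norm_pos_iff.mpr (sub_ne_zero.mpr hwz)
      rwa [slope_def_module, norm_smul, norm_inv, inv_mul_eq_div, le_div_iff₀ h5]
    exact absurd (ge_of_tendsto h1 h2) (not_le.mpr (hε0 N))
  · obtain ⟨N, hN⟩ := (hr.eventually_ge_atTop (M + 1)).exists_forall_of_atTop
    refine ⟨ρ N, fun z hz => ?_⟩
    have hex : ∃ k : ℕ, ‖z‖ < ρ k := by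
      obtain ⟨k, hk⟩ := exists_nat_gt ‖z‖
      exact ⟨k, hk.trans_le (hρn k)⟩
    classical
    have hk := Nat.find_spec hex
    have hNk : N < Nat.find hex := by
      by_contra! hle
      linarith [hρm hle]
    obtain ⟨n, hn⟩ : ∃ n, Nat.find hex = n + 1 := ⟨Nat.find hex - 1, by omega⟩
    have hmin : ρ n ≤ ‖z‖ := not_lt.mp (Nat.find_min hex (m := n) (by omega))
    rw [hn] at hk hNk
    have h1 := hproper n z hmin
    have h2 := hFn (n + 1) z (by linarith)
    have h3 := norm_sub_norm_le (f (n + 1) z) (F z)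
    rw [norm_sub_rev] at h3
    linarith [hN n (by omega), hε1 (n + 1)]

theorem exists_seq_of_forall_exists_step {σ : Type*} {P : ℕ → σ → Prop} {Q : ℕ → σ → σ → Prop}
    (h0 : ∃ s, P 0 s) (h : ∀ n s, P n s → ∃ s', P (n + 1) s' ∧ Q n s s') :
    ∃ u : ℕ → σ, ∀ n, P n (u n) ∧ Q n (u n) (u (n + 1)) := by
  obtain ⟨s, hs⟩ := h0
  choose! g hg hg' using h
  let u : ℕ → σ := fun n => Nat.rec s g n
  have hu (n : ℕ) : P n (u n) := by
    induction n with
    | zero => exact hs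
    | succ n ih => exact hg n _ ih
  exact ⟨u, fun n => ⟨hu n, hg' n _ (hu n)⟩⟩

/-- A stage `(α, ρ, ε)` of the construction: the embedding `z ↦ α (z, 0)` hits the first `n` points
of `e`, avoids a ball outside of the disc of radius `ρ`, and expands distances by at least `2 * ε`
in that disc. -/
structure IsStage (e : ℕ → ℂ × ℂ) (n : ℕ) (s : Equiv.Perm (ℂ × ℂ) × ℝ × ℝ) : Prop where
  mem : s.1 ∈ shearGroup
  le_radius : n ≤ s.2.1
  eps_pos : 0 < s.2.2
  eps_le : s.2.2 ≤ 1
  apply_zero : s.1 (0, 0) = 0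
  hits : ∀ i < n, ∃ z, s.1 (z, 0) = e i
  lt_norm : ∀ z : ℂ, s.2.1 ≤ ‖z‖ → ‖e n‖ / 2 < ‖s.1 (z, 0)‖
  le_norm_sub : ∀ z w : ℂ, ‖z‖ ≤ s.2.1 → ‖w‖ ≤ s.2.1 →
    2 * s.2.2 * ‖z - w‖ ≤ ‖s.1 (z, 0) - s.1 (w, 0)‖

/-- The relation between consecutive stages of the construction. -/
structure IsNextStage (e : ℕ → ℂ × ℂ) (n : ℕ) (s s' : Equiv.Perm (ℂ × ℂ) × ℝ × ℝ) : Prop where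
  eps_le : s'.2.2 ≤ s.2.2 / 2
  radius_le : s.2.1 ≤ s'.2.1
  norm_sub_le : ∀ z : ℂ, ‖z‖ ≤ s.2.1 + 1 → ‖s'.1 (z, 0) - s.1 (z, 0)‖ ≤ s.2.2 / 2
  le_norm : ∀ z : ℂ, s.2.1 ≤ ‖z‖ → ‖e n‖ / 2 - 1 ≤ ‖s'.1 (z, 0)‖
  apply_eq : ∀ i < n, ∀ z, s.1 (z, 0) = e i → s'.1 (z, 0) = e i

theorem exists_isStage_zero (e : ℕ → ℂ × ℂ) : ∃ s, IsStage e 0 s := by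
  refine ⟨(1, ‖e 0‖ / 2 + 1, 1 / 2), one_mem _, ?_, by norm_num, by norm_num, rfl, by simp, ?_, ?_⟩
  · simp only [Nat.cast_zero]; positivity
  · intro z hz
    simp only [Equiv.Perm.one_apply, Prod.norm_mk, norm_zero] at hz ⊢
    exact lt_max_of_lt_left (by linarith)
  · intro z w _ _
    simp

theorem IsStage.exists_next {e : ℕ → ℂ × ℂ} {n : ℕ} {s : Equiv.Perm (ℂ × ℂ) × ℝ × ℝ}
    (h : IsStage e n s) : ∃ s', IsStage e (n + 1) s' ∧ IsNextStage e n s s' := by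
  classical
  obtain ⟨α, ρ, ε⟩ := s
  obtain ⟨hα, hρn, hε0, hε1, h0, hhits, hlt, -⟩ := h
  simp only at hα hρn hε0 hε1 h0 hhits hlt
  have hb : ‖e n‖ / 2 < ‖e n‖ ∨ ∃ z, α (z, 0) = e n := by
    by_cases he : e n = 0
    · exact Or.inr ⟨0, by rw [h0, he]⟩
    · exact Or.inl (half_lt_self (norm_pos_iff.mpr he))
  obtain ⟨Φ, hΦ, hΦr, hΦR, hΦS, hΦb⟩ := exists_step hα (by positivity) (ρ + 1) (half_pos hε0)
    (insert 0 ((Finset.range n).image e)) hb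
  have hmem : Φ * α ∈ shearGroup := mul_mem hΦ hα
  have hfix (i : ℕ) (hi : i < n) (z : ℂ) (hz : α (z, 0) = e i) : (Φ * α) (z, 0) = e i := by
    rw [Equiv.Perm.mul_apply, ← hz]
    refine hΦS z (Finset.mem_insert_of_mem ?_)
    rw [hz]
    exact Finset.mem_image_of_mem e (Finset.mem_range.mpr hi)
  obtain ⟨ρ₁, hρ₁⟩ := exists_lt_norm_of_mem hmem (‖e (n + 1)‖ / 2)
  set ρ' : ℝ := max (ρ + 1) ρ₁ with hρ'
  obtain ⟨c, hc0, hc⟩ := exists_le_norm_sub_of_mem hmem ρ'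
  have hρρ' : ρ + 1 ≤ ρ' := le_max_left _ _
  refine ⟨(Φ * α, ρ', min (ε / 2) (c / 2)), ⟨hmem, ?_, by positivity, ?_, ?_, ?_, ?_, ?_⟩,
    ⟨min_le_left _ _, by simp only; linarith, fun z hz => hΦR z hz, fun z hz => ?_, hfix⟩⟩
  · push_cast
    linarith
  · exact (min_le_left _ _).trans (by linarith)
  · simpa [h0] using hΦS 0 (by simp [h0])
  · intro i hi
    rcases Nat.lt_succ_iff_lt_or_eq.mp hi with hi | rfl
    · obtain ⟨z, hz⟩ := hhits i hi
      exact ⟨z, hfix i hi z hz⟩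
    · exact hΦb
  · exact fun z hz => hρ₁ z ((le_max_right _ _).trans hz)
  · intro z w hz hw
    refine le_trans ?_ (hc z w hz hw)
    gcongr
    linarith [min_le_right (ε / 2) (c / 2)]
  · exact le_norm_apply_of_near_id hΦ (by linarith) hΦr (hlt z hz)

open Filter Topology in
theorem exists_properly_embedded_line_of_tendsto {e : ℕ → ℂ × ℂ}
    (he : Tendsto (fun n => ‖e n‖) atTop atTop) :
    ∃ F : ℂ → ℂ × ℂ, Differentiable ℂ F ∧ Function.Injective F ∧ (∀ z, deriv F z ≠ 0) ∧
      (∀ M : ℝ, ∃ R : ℝ, ∀ z, R ≤ ‖z‖ → M ≤ ‖F z‖) ∧ ∀ n, ∃ z, F z = e n := by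
  obtain ⟨u, hu⟩ := exists_seq_of_forall_exists_step (exists_isStage_zero e)
    fun n s hs => hs.exists_next
  have hP n := (hu n).1
  have hQ n := (hu n).2
  obtain ⟨F, hF, hFi, hFd, hFp, hFlim⟩ := exists_properly_embedded_limit
    (f := fun n z => (u n).1 (z, 0)) (ρ := fun n => (u n).2.1) (ε := fun n => (u n).2.2)
    (r := fun n => ‖e n‖ / 2 - 1)
    (fun n => ((contDiff_of_mem (hP n).mem).differentiable one_ne_zero).comp
      (differentiable_id.prodMk (differentiable_const 0)))
    (fun n => (hP n).le_radius) (fun n => (hQ n).radius_le) (fun n => (hP n).eps_pos)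
    (fun n => (hP n).eps_le) (fun n => (hQ n).eps_le) (fun n => (hP n).le_norm_sub)
    (fun n => (hQ n).norm_sub_le) (fun n => (hQ n).le_norm)
    (tendsto_atTop_add_const_right _ _ (he.atTop_div_const two_pos))
  refine ⟨F, hF, hFi, hFd, hFp, fun n => ?_⟩
  obtain ⟨z, hz⟩ := (hP (n + 1)).hits n n.lt_succ_self
  refine ⟨z, tendsto_nhds_unique (hFlim z) (tendsto_const_nhds.congr' ?_)⟩
  filter_upwards [eventually_ge_atTop (n + 1)] with m hm
  induction m, hm using Nat.le_induction with
  | base => exact hz.symm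
  | succ m hm ih => exact ((hQ m).apply_eq n hm z ih.symm).symm

open Filter in
theorem exists_seq_tendsto_norm_atTop_of_isClosed {E : Type*} [NormedAddCommGroup E]
    [NormedSpace ℝ E] [Nontrivial E] [ProperSpace E] {B : Set E} (hB : IsClosed B)
    (hB' : DiscreteTopology B) :
    ∃ e : ℕ → E, Tendsto (fun n => ‖e n‖) atTop atTop ∧ B ⊆ Set.range e := by
  have : Countable B := countable_of_Lindelof_of_discrete
  obtain ⟨v, hv⟩ := exists_ne (0 : E)
  let f : B ⊕ ℕ → E := Sum.elim (↑) fun n => (n : ℝ) • v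
  obtain ⟨φ⟩ : Nonempty (Denumerable (B ⊕ ℕ)) := nonempty_denumerable _
  have hf : Tendsto (fun x => ‖f x‖) cofinite atTop := by
    refine tendsto_atTop.mpr fun M => ?_
    rw [eventually_cofinite]
    have h1 : {b : B | ‖(b : E)‖ < M}.Finite :=
      (hB.isClosedEmbedding_subtypeVal.isCompact_preimage
        (isCompact_closedBall (0 : E) M)).finite_of_discrete.subset fun b hb => by
          simpa using (show ‖(b : E)‖ < M from hb).le
    have h2 : {n : ℕ | ‖(n : ℝ) • v‖ < M}.Finite := by
      refine (Set.finite_Iio ⌈M / ‖v‖⌉₊).subset fun n hn => ?_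
      rw [Set.mem_ofPred_eq, norm_smul, Real.norm_natCast,
        ← lt_div_iff₀ (norm_pos_iff.mpr hv)] at hn
      exact Nat.lt_ceil.mpr hn
    refine ((h1.image Sum.inl).union (h2.image Sum.inr)).subset ?_
    rintro (b | n) h
    · exact Or.inl ⟨b, not_le.mp h, rfl⟩
    · exact Or.inr ⟨n, not_le.mp h, rfl⟩
  refine ⟨f ∘ (Denumerable.eqv _).symm, ?_, fun b hb =>
    ⟨Denumerable.eqv (B ⊕ ℕ) (Sum.inl ⟨b, hb⟩), by simp [f]⟩⟩
  rw [← Nat.cofinite_eq_atTop]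
  exact hf.comp (Equiv.injective _).tendsto_cofinite

/-- Forstnerič–Globevnik–Rosay: for every closed discrete set B ⊆ ℂ² there is a properly
embedded complex line F : ℂ → ℂ² whose image contains B. -/
theorem properly_embedded_line_through_discrete_set
    (B : Set (EuclideanSpace ℂ (Fin 2)))
    (hBclosed : IsClosed B) (hBdisc : DiscreteTopology B) :
    ∃ F : ℂ → EuclideanSpace ℂ (Fin 2),
      Differentiable ℂ F ∧ Function.Injective F ∧
      (∀ z : ℂ, deriv F z ≠ 0) ∧
      (∀ K : Set (EuclideanSpace ℂ (Fin 2)), IsCompact K → IsCompact (F ⁻¹' K)) ∧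
      B ⊆ Set.range F := by
  obtain ⟨e, he, hBe⟩ := exists_seq_tendsto_norm_atTop_of_isClosed hBclosed hBdisc
  let L : EuclideanSpace ℂ (Fin 2) ≃L[ℂ] ℂ × ℂ :=
    (EuclideanSpace.equiv (Fin 2) ℂ).trans (ContinuousLinearEquiv.finTwoArrow ℂ ℂ)
  have hLe : Filter.Tendsto (fun n => ‖L (e n)‖) Filter.atTop Filter.atTop := by
    rw [tendsto_norm_atTop_iff_cobounded, Metric.cobounded_eq_cocompact] at he ⊢
    exact L.toHomeomorph.isClosedEmbedding.tendsto_cocompact.comp he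
  obtain ⟨F, hF, hFi, hFd, hFp, hFe⟩ := exists_properly_embedded_line_of_tendsto hLe
  refine ⟨L.symm ∘ F, L.symm.differentiable.comp hF, L.symm.injective.comp hFi, fun z => ?_,
    fun K hK => ?_, fun b hb => ?_⟩
  · have h := (L.symm.hasFDerivAt (x := F z)).comp_hasDerivAt z (hF z).hasDerivAt
    rw [h.deriv]
    simpa using hFd z
  · refine Metric.isCompact_of_isClosed_isBounded
      (hK.isClosed.preimage (L.symm.continuous.comp hF.continuous)) ?_
    obtain ⟨M, hM⟩ := (hK.image L.continuous).isBounded.exists_norm_le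
    obtain ⟨R, hR⟩ := hFp (M + 1)
    refine isBounded_iff_forall_norm_le.mpr ⟨R, fun z hz => ?_⟩
    by_contra! hlt
    have h1 := hM (F z) ⟨_, hz, by simp⟩
    linarith [hR z hlt.le]
  · obtain ⟨n, rfl⟩ := hBe hb
    obtain ⟨z, hz⟩ := hFe n
    exact ⟨z, by simp [hz]⟩
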